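/- arXiv:1807.05883 — 5 statements merged into one kernel-verified Lean document; each statement's English description precedes it below -/
import Mathlib

section
/- Let r ≥ 0 be an integer. Suppose (p₀,p₁,p₂,p₃) is a piecewise polynomial vector field of degree ≤ r on the Alfeld split T^z of a tetrahedron T ⊂ ℝ³ which is continuous across interior faces (p_i = p_j on F_{ij} for all i ≠ j), vanishes on the boundary of T (p_i = 0 on F_i for each i), and satisfies div p_i = 0 identically for each i. Then there exists a piecewise polynomial vector field (q₀,q₁,q₂,q₃) of degree ≤ r+1 on T^z such that: (i) q is continuous across interior faces (q_i = q_j on F_{ij}); (ii) curl q is continuous across interior faces (curl q_i = curl q_j on F_{ij}); (iii) q_i = 0 and curl q_i = 0 at every point of the boundary face F_i for each i; and (iv) curl q_i = p_i for each i. -/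
open MvPolynomial Matrix

noncomputable section

namespace Alfeld

abbrev V3 : Type := Fin 3 → ℝ
abbrev P3 : Type := MvPolynomial (Fin 3) ℝ
abbrev VP3 : Type := Fin 3 → P3

/-- Cross product of vectors in `ℝ³`. -/
def cross3 (u v : V3) : V3 := fun c => u (c + 1) * v (c + 2) - u (c + 2) * v (c + 1)

/-- Evaluation of a polynomial vector field at a point. -/
def evalV (p : VP3) (y : V3) : V3 := fun c => eval y (p c)

/-- Gradient of a polynomial. -/
def pgrad (q : P3) : VP3 := fun c => pderiv c q

/-- Curl of a polynomial vector field. -/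
def pcurl (p : VP3) : VP3 := fun c => pderiv (c + 1) (p (c + 2)) - pderiv (c + 2) (p (c + 1))

/-- Divergence of a polynomial vector field. -/
def pdiv (p : VP3) : P3 := ∑ c, pderiv c (p c)

/-- Cross product of polynomial vector fields. -/
def pcross (u v : VP3) : VP3 := fun c => u (c + 1) * v (c + 2) - u (c + 2) * v (c + 1)

/-- All components have total degree at most `r`. -/
def degVle (p : VP3) (r : ℕ) : Prop := ∀ c, (p c).totalDegree ≤ r

/-- Barycenter of the tetrahedron with vertices `x 0, x 1, x 2, x 3`. -/
def bary (x : Fin 4 → V3) : V3 := (4 : ℝ)⁻¹ • (x 0 + x 1 + x 2 + x 3)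

/-- The piece `T_i` of the Alfeld split. -/
def piece (x : Fin 4 → V3) (i : Fin 4) : Set V3 :=
  convexHull ℝ (insert (bary x) (x '' {j | j ≠ i}))

/-- The interior face `F_{ij} = T_i ∩ T_j`. -/
def intFace (x : Fin 4 → V3) (i j : Fin 4) : Set V3 :=
  convexHull ℝ (insert (bary x) (x '' {k | k ≠ i ∧ k ≠ j}))

/-- The boundary face of `T` opposite the vertex `x i`. -/
def bdryFace (x : Fin 4 → V3) (i : Fin 4) : Set V3 :=
  convexHull ℝ (x '' {j | j ≠ i})

/-- `n` is a (Euclidean) unit normal of the interior face `F_{ij}`. -/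
def IsUnitNormalInt (x : Fin 4 → V3) (i j : Fin 4) (n : V3) : Prop :=
  n ⬝ᵥ n = 1 ∧ ∀ k, k ≠ i → k ≠ j → n ⬝ᵥ (x k - bary x) = 0

/-- `n` is a (Euclidean) unit normal of the boundary face `F_i`. -/
def IsUnitNormalBdry (x : Fin 4 → V3) (i : Fin 4) (n : V3) : Prop :=
  n ⬝ᵥ n = 1 ∧ ∀ j k, j ≠ i → k ≠ i → n ⬝ᵥ (x k - x j) = 0

/-- The vertices of the Alfeld split. -/
def vertices (x : Fin 4 → V3) : Set V3 := insert (bary x) (Set.range x)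

/-- Jacobian matrix of a polynomial vector field at a point. -/
def jacob (p : VP3) (a : V3) : Fin 3 → Fin 3 → ℝ := fun c d => eval a (pderiv d (p c))

end Alfeld

open Alfeld

namespace Alfeld

/-- Substitutions that agree modulo `l` give results that agree modulo `l`. -/
theorem dvd_bind₁_sub_bind₁ {σ τ : Type*} (l : MvPolynomial τ ℝ) (f g : σ → MvPolynomial τ ℝ)
    (h : ∀ m, l ∣ f m - g m) (P : MvPolynomial σ ℝ) : l ∣ bind₁ f P - bind₁ g P := by
  have key : (Ideal.Quotient.mkₐ ℝ (Ideal.span {l})).comp (bind₁ f) =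
      (Ideal.Quotient.mkₐ ℝ (Ideal.span {l})).comp (bind₁ g) := by
    apply MvPolynomial.algHom_ext
    intro m
    simp only [AlgHom.comp_apply, bind₁_X_right, Ideal.Quotient.mkₐ_eq_mk]
    exact Ideal.Quotient.eq.2 (Ideal.mem_span_singleton.2 (h m))
  exact Ideal.mem_span_singleton.1 (Ideal.Quotient.eq.1 (by simpa using DFunLike.congr_fun key P))

/-- The affine polynomial with gradient `m` and constant term `a`. -/
def affPoly (a : ℝ) (m : V3) : P3 := C a + ∑ c, C (m c) * X c

theorem eval_affPoly (a : ℝ) (m y : V3) : eval y (affPoly a m) = a + m ⬝ᵥ y := by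
  simp [affPoly, dotProduct]

theorem pderiv_affPoly (a : ℝ) (m : V3) (c : Fin 3) : pderiv c (affPoly a m) = C (m c) := by
  simp [affPoly, pderiv_X, Pi.single_apply]

theorem totalDegree_affPoly_le (a : ℝ) (m : V3) : (affPoly a m).totalDegree ≤ 1 := by
  refine (totalDegree_add _ _).trans (max_le (by simp) (totalDegree_finsetSum_le fun c _ => ?_))
  exact (totalDegree_mul _ _).trans (by simp)

theorem one_le_totalDegree_affPoly (a : ℝ) {m : V3} (hm : m ≠ 0) :
    1 ≤ (affPoly a m).totalDegree := by
  by_contra! h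
  obtain ⟨c, hc⟩ := Function.ne_iff.1 hm
  have h1 := totalDegree_eq_zero_iff_eq_C.1 (Nat.lt_one_iff.1 h)
  have h2 := pderiv_affPoly a m c
  rw [h1, pderiv_C] at h2
  exact hc (C_injective (Fin 3) ℝ (by simpa using h2.symm))

theorem affPoly_ne_zero (a : ℝ) {m : V3} (hm : m ≠ 0) : affPoly a m ≠ 0 := by
  intro h
  have := one_le_totalDegree_affPoly a hm
  simp [h] at this

theorem affPoly_sub (a b : ℝ) (m k : V3) :
    affPoly a m - affPoly b k = affPoly (a - b) (m - k) := by
  simp only [affPoly, Fin.sum_univ_three, Pi.sub_apply, C_sub]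
  ring

/-- The projection along `v` onto the zero plane of `affPoly a m`, acting on polynomials. -/
def planeProj (a : ℝ) (m v : V3) : P3 →ₐ[ℝ] P3 := bind₁ fun c => X c - affPoly a m * C (v c)

theorem eval_bind₁ {σ τ : Type*} (f : σ → MvPolynomial τ ℝ) (y : τ → ℝ) (P : MvPolynomial σ ℝ) :
    eval y (bind₁ f P) = eval (fun m => eval y (f m)) P := by
  simpa using eval₂Hom_bind₁ (RingHom.id ℝ) y f P

theorem eval_planeProj (a : ℝ) (m v y : V3) (P : P3) :
    eval y (planeProj a m v P) = eval (y - (a + m ⬝ᵥ y) • v) P := by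
  rw [planeProj, eval_bind₁]
  refine congrArg (fun z => eval z P) (funext fun c => ?_)
  simp [eval_affPoly]

theorem affPoly_dvd_iff {a : ℝ} {m v : V3} (hv : m ⬝ᵥ v = 1) {P : P3} :
    affPoly a m ∣ P ↔ planeProj a m v P = 0 := by
  constructor
  · rintro ⟨Q, rfl⟩
    rw [map_mul]
    suffices h : planeProj a m v (affPoly a m) = 0 by rw [h, zero_mul]
    apply MvPolynomial.funext
    intro y
    simp [eval_planeProj, eval_affPoly, dotProduct_sub, dotProduct_smul, hv]
  · intro h
    have := dvd_bind₁_sub_bind₁ (affPoly a m) X (fun c => X c - affPoly a m * C (v c))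
      (fun c => by simp) P
    rw [planeProj] at h
    simpa [h] using this

theorem exists_dotProduct_eq_one {m : V3} (hm : m ≠ 0) : ∃ v : V3, m ⬝ᵥ v = 1 := by
  refine ⟨(m ⬝ᵥ m)⁻¹ • m, ?_⟩
  rw [dotProduct_smul, smul_eq_mul, inv_mul_cancel₀]
  simpa using hm

/-- A polynomial vanishing on the zero plane of a nonconstant affine polynomial is divisible
by it. -/
theorem affPoly_dvd_of_eval_eq_zero {a : ℝ} {m : V3} (hm : m ≠ 0) {P : P3}
    (h : ∀ y, a + m ⬝ᵥ y = 0 → eval y P = 0) : affPoly a m ∣ P := by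
  obtain ⟨v, hv⟩ := exists_dotProduct_eq_one hm
  rw [affPoly_dvd_iff hv]
  apply MvPolynomial.funext
  intro y
  rw [eval_planeProj, map_zero]
  apply h
  simp [dotProduct_sub, dotProduct_smul, hv]

theorem affPoly_dvd_of_dvd_mul {a : ℝ} {m : V3} (hm : m ≠ 0) {P Q : P3} {y : V3}
    (hy : a + m ⬝ᵥ y = 0) (hP : eval y P ≠ 0) (h : affPoly a m ∣ P * Q) : affPoly a m ∣ Q := by
  obtain ⟨v, hv⟩ := exists_dotProduct_eq_one hm
  rw [affPoly_dvd_iff hv, map_mul] at h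
  rw [affPoly_dvd_iff hv]
  refine (mul_eq_zero.1 h).resolve_left fun h0 => hP ?_
  simpa [eval_planeProj, hy] using congrArg (eval y) h0

/-- A polynomial vanishing on a short initial segment of a line vanishes on the whole line. -/
theorem eval_eq_zero_of_eventually {σ : Type*} {P : MvPolynomial σ ℝ} {y v : σ → ℝ}
    (h : ∀ᶠ t in nhdsWithin (0 : ℝ) (Set.Ioi 0), eval (y + t • v) P = 0) (t : ℝ) :
    eval (y + t • v) P = 0 := by
  let Q : Polynomial ℝ := aeval (fun c => Polynomial.C (y c) + Polynomial.X * Polynomial.C (v c)) P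
  have hQ : ∀ t, Q.eval t = eval (y + t • v) P := by
    intro t
    simp only [Q, ← Polynomial.coe_evalRingHom]
    rw [map_aeval]
    exact eval₂Hom_congr (RingHom.ext fun a => by simp) (funext fun c => by simp; ring) rfl
  have h0 : Q = 0 := by
    apply Polynomial.eq_zero_of_infinite_isRoot
    obtain ⟨ε, hε, hs⟩ := mem_nhdsGT_iff_exists_Ioo_subset.1 h
    exact (Set.Ioo_infinite hε).mono fun t ht => (hQ t).trans (hs ht)
  rw [← hQ, h0, Polynomial.eval_zero]

/-- A polynomial vanishing on a convex set vanishes at the affine combinations of its points. -/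
theorem eval_affineComb_eq_zero {ι : Type*} {P : P3} {K : Set V3} (hK : Convex ℝ K)
    (hP : ∀ y ∈ K, eval y P = 0) (T : Finset ι) (w : ι → V3) (hw : ∀ m ∈ T, w m ∈ K)
    (a : ι → ℝ) (ha : ∑ m ∈ T, a m = 1) : eval (∑ m ∈ T, a m • w m) P = 0 := by
  have hT : (T.card : ℝ) ≠ 0 := by
    rw [Nat.cast_ne_zero, Finset.card_ne_zero]
    by_contra! h
    simp [h] at ha
  set b : ℝ := (T.card : ℝ)⁻¹
  have hb : 0 < b := by positivity
  have key : ∀ t : ℝ, ∑ m ∈ T, b • w m + t • (∑ m ∈ T, a m • w m - ∑ m ∈ T, b • w m) =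
      ∑ m ∈ T, (b + t * (a m - b)) • w m := by
    intro t
    rw [← Finset.sum_sub_distrib, Finset.smul_sum, ← Finset.sum_add_distrib]
    refine Finset.sum_congr rfl fun m _ => ?_
    module
  have h1 := eval_eq_zero_of_eventually (P := P) (y := ∑ m ∈ T, b • w m)
    (v := ∑ m ∈ T, a m • w m - ∑ m ∈ T, b • w m) ?_ 1
  · simpa using h1
  have h2 : ∀ᶠ t in nhdsWithin (0 : ℝ) (Set.Ioi 0), ∀ m ∈ T, 0 < b + t * (a m - b) := by
    rw [Filter.eventually_all_finset]
    intro m _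
    have : Filter.Tendsto (fun t => b + t * (a m - b)) (nhds (0 : ℝ)) (nhds (b + 0 * (a m - b))) :=
      Continuous.tendsto (by fun_prop) 0
    exact nhdsWithin_le_nhds (this.eventually (lt_mem_nhds (by simpa using hb)))
  filter_upwards [h2] with t ht
  rw [key]
  refine hP _ (hK.sum_mem (fun m hm => (ht m hm).le) ?_ hw)
  rw [Finset.sum_add_distrib, ← Finset.mul_sum, Finset.sum_sub_distrib, ha, Finset.sum_const,
    nsmul_eq_mul, mul_inv_cancel₀ hT]
  ring

theorem totalDegree_bind₁_le {σ τ : Type*} (f : σ → MvPolynomial τ ℝ)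
    (hf : ∀ m, (f m).totalDegree ≤ 1) (P : MvPolynomial σ ℝ) :
    (bind₁ f P).totalDegree ≤ P.totalDegree := by
  conv_lhs => rw [P.as_sum]
  rw [map_sum]
  refine totalDegree_finsetSum_le fun s hs => ?_
  rw [bind₁_monomial]
  refine (totalDegree_mul _ _).trans ?_
  rw [totalDegree_C, zero_add]
  refine (totalDegree_finsetProd _ _).trans (le_trans ?_ (le_totalDegree hs))
  refine Finset.sum_le_sum fun m _ => (totalDegree_pow _ _).trans ?_
  simpa using Nat.mul_le_mul_left (s m) (hf m)

theorem totalDegree_pderiv_le {σ : Type*} (c : σ) (P : MvPolynomial σ ℝ) {r : ℕ}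
    (h : P.totalDegree ≤ r + 1) : (pderiv c P).totalDegree ≤ r := by
  rw [← sum_homogeneousComponent P, map_sum]
  refine totalDegree_finsetSum_le fun n hn => ?_
  refine (homogeneousComponent_isHomogeneous n P).pderiv.totalDegree_le.trans ?_
  have := Finset.mem_range.1 hn
  omega

/-- Homogeneous polynomial functions of degree `n` in four variables. -/
def homFun (n : ℕ) : Submodule ℝ ((Fin 4 → ℝ) → ℝ) where
  carrier := {f | ∃ F : MvPolynomial (Fin 4) ℝ, F.IsHomogeneous n ∧ ∀ u, eval u F = f u}
  add_mem' := by
    rintro f g ⟨F, hF, hf⟩ ⟨G, hG, hg⟩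
    exact ⟨F + G, hF.add hG, fun u => by simp [hf, hg]⟩
  zero_mem' := ⟨0, isHomogeneous_zero _ _ _, fun u => by simp⟩
  smul_mem' := by
    rintro a f ⟨F, hF, hf⟩
    exact ⟨C a * F, by simpa using (isHomogeneous_C _ a).mul hF, fun u => by simp [hf]⟩

theorem homFun_smul_apply {n : ℕ} {f : (Fin 4 → ℝ) → ℝ} (hf : f ∈ homFun n) (a : ℝ)
    (u : Fin 4 → ℝ) : f (a • u) = a ^ n * f u := by
  obtain ⟨F, hF, h⟩ := hf
  rw [← h, ← h, eval_eq, eval_eq, Finset.mul_sum]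
  refine Finset.sum_congr rfl fun d hd => ?_
  have hdn : ∑ m ∈ d.support, d m = n := by
    simpa [Finsupp.weight_apply, Finsupp.sum] using hF (mem_support_iff.1 hd)
  simp only [Pi.smul_apply, smul_eq_mul, mul_pow, Finset.prod_mul_distrib,
    Finset.prod_pow_eq_pow_sum, hdn]
  ring

/-- Setting one variable to zero preserves homogeneous polynomial functions. -/
theorem homFun_update {n : ℕ} {f : (Fin 4 → ℝ) → ℝ} (hf : f ∈ homFun n) (i : Fin 4) :
    (fun u => f (Function.update u i 0)) ∈ homFun n := by
  obtain ⟨F, hF, h⟩ := hf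
  refine ⟨aeval (fun m => if m = i then 0 else X m) F, ?_, fun u => ?_⟩
  · have := hF.aeval (n := 1) (fun m : Fin 4 => if m = i then (0 : MvPolynomial (Fin 4) ℝ) else X m)
      (fun m => by split_ifs; exacts [isHomogeneous_zero _ _ _, isHomogeneous_X _ _])
    simpa using this
  · rw [aeval_eq_bind₁, eval_bind₁]
    refine Eq.trans ?_ (h _)
    refine congrArg (fun z => eval z F) (funext fun m => ?_)
    by_cases hm : m = i
    · simp [hm]
    · simp [hm]

/-- A homogeneous polynomial function vanishing on a face of the standard simplex vanishes on the
cone over it. -/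
theorem homFun_eq_zero_of_simplex {n : ℕ} {f : (Fin 4 → ℝ) → ℝ} (hf : f ∈ homFun n) {i j k : Fin 4}
    (hki : k ≠ i) (hkj : k ≠ j)
    (h : ∀ u, 0 ≤ u → u i = 0 → u j = 0 → ∑ m, u m = 1 → f u = 0)
    {u : Fin 4 → ℝ} (hu : 0 ≤ u) (hi : u i = 0) (hj : u j = 0) : f u = 0 := by
  have hs : 0 ≤ ∑ m, u m := Finset.sum_nonneg fun m _ => hu m
  rcases hs.eq_or_lt with h0 | h0
  · have hu0 : u = (0 : ℝ) • Pi.single k (1 : ℝ) := by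
      ext m
      simpa using (Finset.sum_eq_zero_iff_of_nonneg fun m _ => hu m).1 h0.symm m (Finset.mem_univ m)
    rw [hu0, homFun_smul_apply hf, h _ (Pi.single_nonneg.2 zero_le_one), mul_zero]
    · simp [hki.symm]
    · simp [hkj.symm]
    · simp
  · have hu1 : u = (∑ m, u m) • (∑ m, u m)⁻¹ • u := by rw [smul_inv_smul₀ h0.ne']
    rw [hu1, homFun_smul_apply hf, h _ (smul_nonneg (inv_nonneg.2 hs) hu), mul_zero]
    · simp [hi]
    · simp [hj]
    · simp [← Finset.mul_sum, h0.ne']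

/-- Boolean sum interpolation: homogeneous polynomial functions on coordinate facets of the positive
orthant that agree on the common parts have a common homogeneous polynomial extension. -/
theorem exists_homFun_extension {n : ℕ} (S : Finset (Fin 4)) (f : Fin 4 → (Fin 4 → ℝ) → ℝ)
    (hf : ∀ i ∈ S, f i ∈ homFun n)
    (h : ∀ i ∈ S, ∀ j ∈ S, i ≠ j → ∀ u, 0 ≤ u → u i = 0 → u j = 0 → f i u = f j u) :
    ∃ g ∈ homFun n, ∀ i ∈ S, ∀ u, 0 ≤ u → u i = 0 → g u = f i u := by
  induction S using Finset.induction_on with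
  | empty => exact ⟨0, zero_mem _, by simp⟩
  | insert i S hi ih =>
    obtain ⟨g, hg, hgS⟩ := ih (fun j hj => hf j (Finset.mem_insert_of_mem hj))
      (fun j hj k hk => h j (Finset.mem_insert_of_mem hj) k (Finset.mem_insert_of_mem hk))
    refine ⟨fun u => g u + (f i (Function.update u i 0) - g (Function.update u i 0)),
      add_mem hg (sub_mem (homFun_update (hf i (Finset.mem_insert_self i S)) i)
        (homFun_update hg i)), fun j hj u hu huj => ?_⟩
    rcases Finset.mem_insert.1 hj with rfl | hjS
    · have hup : Function.update u j 0 = u := by rw [← huj, Function.update_eq_self]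
      simp only [hup]
      ring
    · have hij : i ≠ j := fun hij => hi (hij ▸ hjS)
      have hu' : 0 ≤ Function.update u i 0 := by
        intro m
        by_cases hm : m = i
        · simp [hm]
        · simpa [hm] using hu m
      have huj' : Function.update u i 0 j = 0 := by simp [hij.symm, huj]
      simp only
      rw [hgS j hjS u hu huj, hgS j hjS _ hu' huj',
        h i (Finset.mem_insert_self i S) j hj hij _ hu' (by simp) huj']
      ring

/-- Homogenization: in barycentric coordinates a polynomial of degree at most `n` is homogeneous
of degree `n`. -/
theorem exists_homogenization (x : Fin 4 → V3) {n : ℕ} {P : P3} (hP : P.totalDegree ≤ n) :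
    ∃ f ∈ homFun n, ∀ u, ∑ m, u m = 1 → f u = eval (∑ m, u m • x m) P := by
  let L : Fin 3 → MvPolynomial (Fin 4) ℝ := fun c => ∑ m, C (x m c) * X m
  have hL : ∀ c, (L c).IsHomogeneous 1 := fun c =>
    IsHomogeneous.sum _ _ _ fun m _ => by
      simpa using (isHomogeneous_C _ (x m c)).mul (isHomogeneous_X ℝ m)
  have hX : (∑ m : Fin 4, X m : MvPolynomial (Fin 4) ℝ).IsHomogeneous 1 :=
    IsHomogeneous.sum _ _ _ fun m _ => isHomogeneous_X ℝ m
  let F := ∑ k ∈ Finset.range (P.totalDegree + 1),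
    aeval L (homogeneousComponent k P) * (∑ m : Fin 4, X m) ^ (n - k)
  refine ⟨fun u => eval u F, ⟨F, IsHomogeneous.sum _ _ _ fun k hk => ?_, fun u => rfl⟩,
    fun u hu => ?_⟩
  · have h1 := ((homogeneousComponent_isHomogeneous k P).aeval L hL).mul (hX.pow (n - k))
    have := Finset.mem_range.1 hk
    rwa [show 1 * k + 1 * (n - k) = n by omega] at h1
  · have hLu : (fun c => eval u (L c)) = ∑ m, u m • x m := by
      ext c
      simp [L, mul_comm]
    conv_rhs => rw [← sum_homogeneousComponent P]
    simp only [F, map_sum, map_mul, map_pow, eval_X, hu, one_pow, mul_one]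
    refine Finset.sum_congr rfl fun k _ => ?_
    rw [aeval_eq_bind₁, eval_bind₁, hLu]

/-- The vectors from the barycenter to the vertices. -/
def spoke (x : Fin 4 → V3) (i : Fin 4) : V3 := x i - bary x

/-- `n i` is the gradient of the `i`-th barycentric coordinate, scaled to be one at the
barycenter. -/
structure IsFrame (x n : Fin 4 → V3) : Prop where
  dual : ∀ i m, n i ⬝ᵥ spoke x m = if i = m then 3 else -1
  recon : ∀ v, v = ∑ m, (n m ⬝ᵥ v / 4) • spoke x m
  recon' : ∀ v, v = ∑ m, (v ⬝ᵥ spoke x m / 4) • n m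

theorem exists_isFrame {x : Fin 4 → V3} (hx : AffineIndependent ℝ x) : ∃ n, IsFrame x n := by
  have htop : affineSpan ℝ (Set.range x) = ⊤ := by
    rw [hx.affineSpan_eq_top_iff_card_eq_finrank_add_one]
    simp
  let b : AffineBasis (Fin 4) ℝ V3 := ⟨x, hx, htop⟩
  have hlin : ∀ m (v : V3), (fun c => 4 * (b.coord m).linear (Pi.single c 1)) ⬝ᵥ v =
      4 * (b.coord m).linear v := by
    intro m v
    conv_rhs => rw [pi_eq_sum_univ' v]
    simp only [map_sum, map_smul, smul_eq_mul, dotProduct, Finset.mul_sum]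
    refine Finset.sum_congr rfl fun c _ => ?_
    ring
  have hsub : ∀ m (y y' : V3), (b.coord m).linear (y - y') = b.coord m y - b.coord m y' :=
    fun m y y' => (b.coord m).linearMap_vsub y y'
  have hcx : ∀ m k, b.coord m (x k) = if m = k then 1 else 0 := fun m k => b.coord_apply m k
  have hx0 : ∀ k, spoke x k = ∑ j, (4 : ℝ)⁻¹ • (x k - x j) := by
    intro k
    simp only [spoke, bary, Fin.sum_univ_four]
    module
  have dual : ∀ i m, (fun c => 4 * (b.coord i).linear (Pi.single c 1)) ⬝ᵥ spoke x m =
      if i = m then 3 else -1 := by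
    intro i m
    rw [hlin, hx0, map_sum]
    simp only [map_smul, hsub, hcx, smul_eq_mul]
    fin_cases i <;> fin_cases m <;> simp [Fin.sum_univ_four] <;> norm_num
  have recon : ∀ v, v = ∑ m, ((fun c => 4 * (b.coord m).linear (Pi.single c 1)) ⬝ᵥ v / 4) •
      spoke x m := by
    intro v
    have hl : ∀ m, (b.coord m).linear v = b.coord m (v + bary x) - b.coord m (bary x) := by
      intro m
      rw [← hsub, add_sub_cancel_right]
    have h1 : ∑ m, b.coord m (v + bary x) • x m = v + bary x :=
      b.linear_combination_coord_eq_self _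
    have h2 : ∑ m, b.coord m (bary x) • x m = bary x := b.linear_combination_coord_eq_self _
    have h3 := b.sum_coord_apply_eq_one (v + bary x)
    have h4 := b.sum_coord_apply_eq_one (bary x)
    simp only [hlin, hl, mul_div_cancel_left₀ _ (four_ne_zero (α := ℝ)), spoke, smul_sub, sub_smul,
      Finset.sum_sub_distrib, h1, h2, ← Finset.sum_smul, h3, h4]
    module
  refine ⟨_, dual, recon, fun v => ?_⟩
  have key : ∀ w : V3, v ⬝ᵥ w = (∑ m, (v ⬝ᵥ spoke x m / 4) •
      (fun c => 4 * (b.coord m).linear (Pi.single c 1))) ⬝ᵥ w := by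
    intro w
    conv_lhs => rw [recon w]
    rw [dotProduct_sum, sum_dotProduct]
    refine Finset.sum_congr rfl fun m _ => ?_
    rw [dotProduct_smul, smul_dotProduct, smul_eq_mul, smul_eq_mul]
    ring
  exact dotProduct_eq _ _ key

variable {x n : Fin 4 → V3}

namespace IsFrame

theorem sum_eq_zero (h : IsFrame x n) : ∑ m, n m = 0 := by
  rw [h.recon' (∑ m, n m)]
  refine Finset.sum_eq_zero fun m _ => ?_
  have : (∑ k, n k) ⬝ᵥ spoke x m = 0 := by
    simp only [sum_dotProduct, h.dual]
    fin_cases m <;> simp [Fin.sum_univ_four] <;> norm_num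
  rw [this, zero_div, zero_smul]

theorem ne_zero (h : IsFrame x n) (i : Fin 4) : n i ≠ 0 := by
  intro h0
  simpa [h0] using h.dual i i

theorem sub_ne_zero (h : IsFrame x n) {i j : Fin 4} (hij : i ≠ j) : n i - n j ≠ 0 := by
  intro h0
  have h1 := h.dual i i
  rw [sub_eq_zero.1 h0, h.dual, if_neg hij.symm] at h1
  norm_num at h1

end IsFrame

/-- The barycentric coordinate with gradient `n i`, scaled to be one at the barycenter. -/
def baryPoly (x n : Fin 4 → V3) (i : Fin 4) : P3 := affPoly (1 - n i ⬝ᵥ bary x) (n i)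

theorem eval_baryPoly (x n : Fin 4 → V3) (i : Fin 4) (y : V3) :
    eval y (baryPoly x n i) = 1 + n i ⬝ᵥ (y - bary x) := by
  rw [baryPoly, eval_affPoly, dotProduct_sub]
  ring

theorem baryPoly_sub (x n : Fin 4 → V3) (i j : Fin 4) : baryPoly x n i - baryPoly x n j =
    affPoly ((1 - n i ⬝ᵥ bary x) - (1 - n j ⬝ᵥ bary x)) (n i - n j) := affPoly_sub _ _ _ _

theorem eval_baryPoly_vertex (h : IsFrame x n) (i m : Fin 4) :
    eval (x m) (baryPoly x n i) = if i = m then 4 else 0 := by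
  have := h.dual i m
  rw [spoke] at this
  rw [eval_baryPoly, this]
  split_ifs <;> norm_num

theorem eval_baryPoly_bary (x n : Fin 4 → V3) (i : Fin 4) :
    eval (bary x) (baryPoly x n i) = 1 := by
  simp [eval_baryPoly]

/-- Every point is the combination of the vertices given by its barycentric coordinates. -/
theorem eq_sum_baryPoly (h : IsFrame x n) (y : V3) :
    y = ∑ m, (eval y (baryPoly x n m) / 4) • x m := by
  have h1 := h.recon (y - bary x)
  simp only [spoke, smul_sub, Finset.sum_sub_distrib] at h1
  have h2 : ∑ m, n m ⬝ᵥ (y - bary x) / 4 = 0 := by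
    rw [← Finset.sum_div, ← sum_dotProduct, h.sum_eq_zero]
    simp
  rw [← Finset.sum_smul, h2, zero_smul, sub_zero, sub_eq_iff_eq_add] at h1
  simp only [eval_baryPoly, add_div, add_smul, Finset.sum_add_distrib]
  rw [add_comm]
  conv_lhs => rw [h1]
  congr 1
  simp only [bary, Fin.sum_univ_four]
  module

theorem sum_eval_baryPoly (h : IsFrame x n) (y : V3) :
    ∑ m, eval y (baryPoly x n m) / 4 = 1 := by
  rw [← Finset.sum_div]
  simp only [eval_baryPoly, Finset.sum_add_distrib, ← sum_dotProduct, h.sum_eq_zero]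
  simp

theorem baryPoly_dvd_of_bdryFace (h : IsFrame x n) (i : Fin 4) {P : P3}
    (hP : ∀ y ∈ bdryFace x i, eval y P = 0) : baryPoly x n i ∣ P := by
  refine affPoly_dvd_of_eval_eq_zero (h.ne_zero i) fun y hy => ?_
  rw [← eval_affPoly, ← baryPoly] at hy
  have hsum := fun (M : Type) [AddCommMonoid M] (f : Fin 4 → M) (hf : f i = 0) =>
    (Finset.sum_erase Finset.univ hf)
  rw [eq_sum_baryPoly h y, ← hsum _ _ (by simp [hy])]
  refine eval_affineComb_eq_zero (convex_convexHull ℝ _) hP _ x (fun m hm => ?_) _ ?_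
  · exact subset_convexHull ℝ _ ⟨m, Finset.ne_of_mem_erase hm, rfl⟩
  · rw [hsum _ _ (by simp [hy]), sum_eval_baryPoly h]

theorem baryPoly_sub_dvd_of_intFace (h : IsFrame x n) {i j : Fin 4} (hij : i ≠ j) {P : P3}
    (hP : ∀ y ∈ intFace x i j, eval y P = 0) : baryPoly x n i - baryPoly x n j ∣ P := by
  rw [baryPoly_sub]
  refine affPoly_dvd_of_eval_eq_zero (h.sub_ne_zero hij) fun y hy => ?_
  rw [← eval_affPoly, ← baryPoly_sub, map_sub, sub_eq_zero] at hy
  let a : Fin 4 → ℝ := fun m => (eval y (baryPoly x n m) - eval y (baryPoly x n i)) / 4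
  have ha : a i = 0 ∧ a j = 0 := by simp [a, hy]
  have hsum : ∑ m, a m = 1 - eval y (baryPoly x n i) := by
    have := sum_eval_baryPoly h y
    simp only [a, sub_div, Finset.sum_sub_distrib, this]
    simp
    ring
  have hy' : y = ∑ m ∈ Finset.insertNone ((Finset.univ.erase i).erase j),
      (m.elim (eval y (baryPoly x n i)) a) • (m.elim (bary x) x) := by
    rw [Finset.sum_insertNone]
    simp only [Option.elim_none, Option.elim_some]
    rw [Finset.sum_erase _ (by simp [ha]), Finset.sum_erase _ (by simp [ha])]
    conv_lhs => rw [eq_sum_baryPoly h y]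
    simp only [a, Fin.sum_univ_four, bary]
    module
  rw [hy']
  refine eval_affineComb_eq_zero (convex_convexHull ℝ _) hP _ _ (fun m hm => ?_) _ ?_
  · refine subset_convexHull ℝ _ ?_
    rcases m with _ | m
    · exact Set.mem_insert _ _
    · have := Finset.some_mem_insertNone.1 hm
      simp only [Finset.mem_erase] at this
      exact Set.mem_insert_of_mem _ ⟨m, ⟨this.2.1, this.1⟩, rfl⟩
  · rw [Finset.sum_insertNone]
    simp only [Option.elim_none, Option.elim_some]
    rw [Finset.sum_erase _ (by simp [ha]), Finset.sum_erase _ (by simp [ha]), hsum]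
    ring

theorem eval_baryPoly_combo (x n : Fin 4 → V3) (i : Fin 4) (y z : V3) {a b : ℝ}
    (hab : a + b = 1) : eval (a • y + b • z) (baryPoly x n i) =
      a * eval y (baryPoly x n i) + b * eval z (baryPoly x n i) := by
  simp only [baryPoly, eval_affPoly, dotProduct_add, dotProduct_smul, smul_eq_mul]
  linear_combination (n i ⬝ᵥ bary x - 1) * hab

theorem eval_baryPoly_of_mem_bdryFace (h : IsFrame x n) {i : Fin 4} {y : V3}
    (hy : y ∈ bdryFace x i) :
    eval y (baryPoly x n i) = 0 ∧ ∀ m, 0 ≤ eval y (baryPoly x n m) := by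
  refine convexHull_min (t := {y | eval y (baryPoly x n i) = 0 ∧
    ∀ m, 0 ≤ eval y (baryPoly x n m)}) ?_ ?_ hy
  · rintro _ ⟨k, hk, rfl⟩
    refine ⟨by rw [eval_baryPoly_vertex h, if_neg (Ne.symm hk)], fun m => ?_⟩
    rw [eval_baryPoly_vertex h]
    split_ifs <;> norm_num
  · intro y hy z hz a b ha hb hab
    refine ⟨by rw [eval_baryPoly_combo _ _ _ _ _ hab, hy.1, hz.1]; simp, fun m => ?_⟩
    rw [eval_baryPoly_combo _ _ _ _ _ hab]
    exact add_nonneg (mul_nonneg ha (hy.2 m)) (mul_nonneg hb (hz.2 m))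

theorem eval_baryPoly_of_mem_intFace (h : IsFrame x n) {i j : Fin 4} {y : V3}
    (hy : y ∈ intFace x i j) : eval y (baryPoly x n i) = eval y (baryPoly x n j) := by
  refine convexHull_min (t := {y | eval y (baryPoly x n i) = eval y (baryPoly x n j)}) ?_ ?_ hy
  · rintro _ (rfl | ⟨k, hk, rfl⟩)
    · simp only [Set.mem_ofPred_eq, eval_baryPoly_bary]
    · simp only [Set.mem_ofPred_eq, eval_baryPoly_vertex h, if_neg hk.1.symm, if_neg hk.2.symm]
  · intro y hy z hz a b _ _ hab
    simp only [Set.mem_ofPred_eq] at hy hz ⊢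
    rw [eval_baryPoly_combo _ _ _ _ _ hab, eval_baryPoly_combo _ _ _ _ _ hab, hy, hz]

theorem eval_baryPoly_sum (h : IsFrame x n) {u : Fin 4 → ℝ} (hu : ∑ m, u m = 1) (i : Fin 4) :
    eval (∑ m, u m • x m) (baryPoly x n i) = 4 * u i := by
  have h1 : ∑ m, u m • x m - bary x = ∑ m, u m • spoke x m := by
    simp only [spoke, smul_sub, Finset.sum_sub_distrib, ← Finset.sum_smul, hu, one_smul]
  simp only [eval_baryPoly, h1, dotProduct_sum, dotProduct_smul, h.dual, smul_eq_mul]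
  have h2 : ∑ m, u m * (if i = m then (3 : ℝ) else -1) = 4 * u i - ∑ m, u m := by
    fin_cases i <;> simp [Fin.sum_univ_four] <;> ring
  rw [h2, hu]
  ring

theorem cross3_eq (u v : V3) :
    cross3 u v = ![u 1 * v 2 - u 2 * v 1, u 2 * v 0 - u 0 * v 2, u 0 * v 1 - u 1 * v 0] := by
  ext c
  fin_cases c <;> rfl

theorem cross3_cross3_self (m g : V3) (h : m ⬝ᵥ g = 0) :
    cross3 m (cross3 g m) = (m ⬝ᵥ m) • g := by
  simp only [dotProduct, Fin.sum_univ_three] at h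
  simp only [cross3_eq, dotProduct, Fin.sum_univ_three]
  ext c
  fin_cases c
  · simp
    linear_combination (-m 0) * h
  · simp
    linear_combination (-m 1) * h
  · simp
    linear_combination (-m 2) * h

theorem cross3_dotProduct_cross3 (a b c d : V3) :
    cross3 a b ⬝ᵥ cross3 c d = (a ⬝ᵥ c) * (b ⬝ᵥ d) - (a ⬝ᵥ d) * (b ⬝ᵥ c) := by
  simp only [cross3_eq, dotProduct, Fin.sum_univ_three]
  simp
  ring

/-- A vector orthogonal to `p × q` is a combination of `p` and `q`, with coefficients given by a
dual pair. -/
theorem eq_combo_of_dotProduct_cross3 {p q c c' d : V3} (hpc : p ⬝ᵥ c = 1) (hqc : q ⬝ᵥ c = 0)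
    (hpc' : p ⬝ᵥ c' = 0) (hqc' : q ⬝ᵥ c' = 1) (hd : d ⬝ᵥ cross3 p q = 0) :
    d = (d ⬝ᵥ c) • p + (d ⬝ᵥ c') • q := by
  set s := d - ((d ⬝ᵥ c) • p + (d ⬝ᵥ c') • q) with hs
  have h1 : s ⬝ᵥ c = 0 := by
    simp [hs, sub_dotProduct, add_dotProduct, smul_dotProduct, hpc, hqc]
  have h2 : s ⬝ᵥ c' = 0 := by
    simp [hs, sub_dotProduct, add_dotProduct, smul_dotProduct, hpc', hqc']
  have h3 : s ⬝ᵥ cross3 p q = 0 := by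
    rw [hs, sub_dotProduct, hd]
    simp only [cross3_eq, dotProduct, Fin.sum_univ_three]
    simp
    ring
  have h4 : cross3 c c' ⬝ᵥ cross3 p q = 1 := by
    rw [cross3_dotProduct_cross3]
    simp [dotProduct_comm c, dotProduct_comm c', *]
  have key : (cross3 c c' ⬝ᵥ cross3 p q) • s = (s ⬝ᵥ cross3 p q) • cross3 c c' +
      cross3 (cross3 p q) ((s ⬝ᵥ c') • c - (s ⬝ᵥ c) • c') := by
    simp only [cross3_eq, dotProduct, Fin.sum_univ_three]
    ext k
    fin_cases k <;> simp <;> ring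
  rw [h1, h2, h3, h4] at key
  refine sub_eq_zero.1 (hs.symm.trans ?_)
  have h0 : cross3 (cross3 p q) 0 = 0 := by
    ext k
    simp [cross3]
  simpa [h0] using key

/-- Homogeneous fields on the coordinate facets whose jumps across the edges are normal to the edges
can be corrected by normal multiples so as to have a common homogeneous extension. -/
theorem exists_compatible_normal_part (h : IsFrame x n) {N : ℕ}
    (V : Fin 4 → Fin 3 → (Fin 4 → ℝ) → ℝ) (hV : ∀ i c, V i c ∈ homFun N)
    (hVn : ∀ i j, i ≠ j → ∀ u, 0 ≤ u → u i = 0 → u j = 0 → ∑ m, u m = 1 →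
      (fun c => V j c u - V i c u) ⬝ᵥ cross3 (n i) (n j) = 0) :
    ∃ W : Fin 3 → (Fin 4 → ℝ) → ℝ, (∀ c, W c ∈ homFun N) ∧
      ∀ i, ∃ a : (Fin 4 → ℝ) → ℝ, ∀ c u, 0 ≤ u → u i = 0 → W c u = V i c u + a u * n i c := by
  let d : Fin 4 → Fin 4 → V3 := fun i j => (8 : ℝ)⁻¹ • ((3 : ℝ) • spoke x i + spoke x j)
  have hd1 : ∀ i j, i ≠ j → n i ⬝ᵥ d i j = 1 := by
    intro i j hij
    simp only [d, dotProduct_smul, dotProduct_add, h.dual, if_neg hij]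
    norm_num
  have hd2 : ∀ i j, i ≠ j → n j ⬝ᵥ d i j = 0 := by
    intro i j hij
    simp only [d, dotProduct_smul, dotProduct_add, h.dual, if_neg hij.symm]
    norm_num
  let β : Fin 4 → Fin 4 → (Fin 4 → ℝ) → ℝ := fun i j => ∑ c, d i j c • (V j c - V i c)
  have hβ : ∀ i j, β i j ∈ homFun N := fun i j =>
    Submodule.sum_mem _ fun c _ => Submodule.smul_mem _ _ (sub_mem (hV j c) (hV i c))
  have hβu : ∀ i j u, β i j u = (fun c => V j c u - V i c u) ⬝ᵥ d i j := by
    intro i j u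
    simp [β, dotProduct, mul_comm]
  have K : ∀ i j, i ≠ j → ∀ u, 0 ≤ u → u i = 0 → u j = 0 → ∀ c,
      V j c u - V i c u = β i j u * n i c - β j i u * n j c := by
    intro i j hij u hu hi hj c
    obtain ⟨k, hki, hkj⟩ : ∃ k, k ≠ i ∧ k ≠ j := by
      clear * -
      revert i j
      decide
    have hmem : V j c - V i c - (n i c • β i j - n j c • β j i) ∈ homFun N :=
      sub_mem (sub_mem (hV j c) (hV i c))
        (sub_mem (Submodule.smul_mem _ _ (hβ i j)) (Submodule.smul_mem _ _ (hβ j i)))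
    have := homFun_eq_zero_of_simplex hmem hki hkj (fun u hu hi hj hsum => ?_) hu hi hj
    · simp only [Pi.sub_apply, Pi.smul_apply, smul_eq_mul] at this
      linear_combination this
    · have h1 := congrFun (eq_combo_of_dotProduct_cross3 (hd1 i j hij) (hd2 i j hij)
        (hd2 j i hij.symm) (hd1 j i hij.symm) (hVn i j hij u hu hi hj hsum)) c
      have h2 : β j i u = -((fun c => V j c u - V i c u) ⬝ᵥ d j i) := by
        rw [hβu]
        simp [dotProduct, Fin.sum_univ_three]
        ring
      simp only [Pi.add_apply, Pi.smul_apply, smul_eq_mul] at h1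
      simp only [Pi.sub_apply, Pi.smul_apply, smul_eq_mul, h2, hβu i j]
      linear_combination h1
  have hvert : ∀ i j k, i ≠ j → i ≠ k → j ≠ k → ∀ u, 0 ≤ u → u i = 0 → u j = 0 → u k = 0 →
      β i j u = β i k u := by
    intro i j k hij hik hjk u hu hi hj hk
    obtain ⟨l, hli, hlj, hlk⟩ : ∃ l, l ≠ i ∧ l ≠ j ∧ l ≠ k := by
      clear * -
      revert i j k
      decide
    have h1 : (β i j u - β i k u) • n i + (β j k u - β j i u) • n j +
        (β k i u - β k j u) • n k = 0 := by
      ext c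
      simp only [Pi.add_apply, Pi.smul_apply, smul_eq_mul, Pi.zero_apply]
      linear_combination (-1) * K i j hij u hu hi hj c - K j k hjk u hu hj hk c +
        K i k hik u hu hi hk c
    have h2 := congrArg (· ⬝ᵥ (spoke x i - spoke x l)) h1
    simp only [add_dotProduct, smul_dotProduct, dotProduct_sub, h.dual, if_neg hli.symm,
      if_neg hlj.symm, if_neg hlk.symm, if_neg hij.symm, if_neg hik.symm, zero_dotProduct,
      smul_eq_mul, if_true] at h2
    linarith
  have ha : ∀ i, ∃ a ∈ homFun N, ∀ j, j ≠ i → ∀ u, 0 ≤ u → u i = 0 → u j = 0 →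
      a u = β i j u := by
    intro i
    obtain ⟨a, ha, haS⟩ := exists_homFun_extension (Finset.univ.erase i)
      (fun j u => β i j (Function.update u i 0)) (fun j _ => homFun_update (hβ i j) i) (by
        intro j hj k hk hjk u hu huj huk
        have hji := Finset.ne_of_mem_erase hj
        have hki := Finset.ne_of_mem_erase hk
        refine hvert i j k hji.symm hki.symm hjk _ (fun m => ?_) (by simp)
          (by simp [hji, huj]) (by simp [hki, huk])
        by_cases hm : m = i
        · simp [hm]
        · simpa [hm] using hu m)
    refine ⟨a, ha, fun j hj u hu hi huj => ?_⟩
    rw [haS j (by simp [hj]) u hu huj]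
    have : Function.update u i 0 = u := by rw [← hi, Function.update_eq_self]
    rw [this]
  choose a ha haβ using ha
  have hW : ∀ c, ∃ w ∈ homFun N, ∀ i ∈ Finset.univ, ∀ u, 0 ≤ u → u i = 0 →
      w u = (V i c + n i c • a i) u := fun c =>
    exists_homFun_extension Finset.univ (fun i => V i c + n i c • a i)
      (fun i _ => add_mem (hV i c) (Submodule.smul_mem _ _ (ha i))) (by
        intro i _ j _ hij u hu hi hj
        simp only [Pi.add_apply, Pi.smul_apply, smul_eq_mul, haβ i j hij.symm u hu hi hj,
          haβ j i hij u hu hj hi]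
        linear_combination (-1) * K i j hij u hu hi hj c)
  choose W hW hWV using hW
  refine ⟨W, hW, fun i => ⟨a i, fun c u hu hi => ?_⟩⟩
  rw [hWV c i (Finset.mem_univ i) u hu hi]
  simp [mul_comm]

/-- Tangential boundary data which are compatible across the edges have a common polynomial
potential `W`, in the sense that `n i × W` is the prescribed field on the `i`-th boundary face. -/
theorem exists_tangential_lift (h : IsFrame x n) {N : ℕ} (g : Fin 4 → VP3)
    (hg : ∀ i c, (g i c).totalDegree ≤ N)
    (hN : ∀ i j, i ≠ j → baryPoly x n i - baryPoly x n j ∣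
      ∑ c, (g i c - g j c) * C (n i c - n j c))
    (hD : ∀ i, baryPoly x n i ∣ ∑ c, C (n i c) * g i c) :
    ∃ W : Fin 3 → MvPolynomial (Fin 4) ℝ, (∀ c, (W c).IsHomogeneous N) ∧
      ∀ i u, 0 ≤ u → u i = 0 → ∑ m, u m = 1 →
        cross3 (n i) (fun c => eval u (W c)) = evalV (g i) (∑ m, u m • x m) := by
  have hn : ∀ i, n i ⬝ᵥ n i ≠ 0 := fun i => by simpa using h.ne_zero i
  have hv : ∀ i c, ∃ f ∈ homFun N, ∀ u, ∑ m, u m = 1 →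
      f u = (n i ⬝ᵥ n i)⁻¹ * cross3 (evalV (g i) (∑ m, u m • x m)) (n i) c := by
    intro i c
    obtain ⟨f, hf, hfu⟩ := exists_homogenization x (n := N)
      (P := C (n i ⬝ᵥ n i)⁻¹ * (g i (c + 1) * C (n i (c + 2)) - g i (c + 2) * C (n i (c + 1)))) (by
        refine (totalDegree_mul _ _).trans ?_
        rw [totalDegree_C, zero_add]
        refine (totalDegree_sub _ _).trans (max_le ?_ ?_) <;>
          exact (totalDegree_mul _ _).trans (by simpa using hg i _))
    exact ⟨f, hf, fun u hu => by rw [hfu u hu]; simp [cross3, evalV]⟩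
  choose V hV hVu using hv
  have hG : ∀ i (u : Fin 4 → ℝ), u i = 0 → ∑ m, u m = 1 →
      n i ⬝ᵥ evalV (g i) (∑ m, u m • x m) = 0 := by
    intro i u hi hu
    obtain ⟨Q, hQ⟩ := hD i
    have := congrArg (eval (∑ m, u m • x m)) hQ
    rw [map_mul, eval_baryPoly_sum h hu, hi] at this
    simpa [dotProduct, evalV] using this
  have hGN : ∀ i j, i ≠ j → ∀ u : Fin 4 → ℝ, u i = 0 → u j = 0 → ∑ m, u m = 1 →
      (evalV (g i) (∑ m, u m • x m) - evalV (g j) (∑ m, u m • x m)) ⬝ᵥ (n i - n j) = 0 := by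
    intro i j hij u hi hj hu
    obtain ⟨Q, hQ⟩ := hN i j hij
    have := congrArg (eval (∑ m, u m • x m)) hQ
    rw [map_mul, map_sub, eval_baryPoly_sum h hu, eval_baryPoly_sum h hu, hi, hj] at this
    simpa [dotProduct, evalV] using this
  obtain ⟨W, hW, hWV⟩ := exists_compatible_normal_part h V hV (by
    intro i j hij u _ hi hj hu
    have h1 : (fun c => V j c u - V i c u) =
        (n j ⬝ᵥ n j)⁻¹ • cross3 (evalV (g j) (∑ m, u m • x m)) (n j) -
        (n i ⬝ᵥ n i)⁻¹ • cross3 (evalV (g i) (∑ m, u m • x m)) (n i) := by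
      ext c
      simp [hVu _ _ u hu]
    have h2 := hG i u hi hu
    have h3 := hG j u hj hu
    have h4 := hGN i j hij u hi hj hu
    rw [dotProduct_comm] at h2 h3
    rw [sub_dotProduct, dotProduct_sub, dotProduct_sub, h2, h3] at h4
    rw [h1, sub_dotProduct, smul_dotProduct, smul_dotProduct, cross3_dotProduct_cross3,
      cross3_dotProduct_cross3, h2, h3, smul_eq_mul, smul_eq_mul]
    linear_combination (evalV (g j) (∑ m, u m • x m) ⬝ᵥ n i) * inv_mul_cancel₀ (hn j) +
      (evalV (g i) (∑ m, u m • x m) ⬝ᵥ n j) * inv_mul_cancel₀ (hn i) - h4)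
  choose F hF hFW using hW
  refine ⟨F, hF, fun i u hu hi hsum => ?_⟩
  obtain ⟨a, ha⟩ := hWV i
  have h1 : (fun c => eval u (F c)) =
      (n i ⬝ᵥ n i)⁻¹ • cross3 (evalV (g i) (∑ m, u m • x m)) (n i) + a u • n i := by
    ext c
    rw [hFW, ha c u hu hi, hVu i c u hsum]
    simp
  have h2 : ∀ (v m : V3) (s t : ℝ), cross3 m (s • v + t • m) = s • cross3 m v := by
    intro v m s t
    ext c
    simp only [cross3, Pi.add_apply, Pi.smul_apply, smul_eq_mul]
    ring
  rw [h1, h2, cross3_cross3_self _ _ (hG i u hi hsum), inv_smul_smul₀ (hn i)]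

theorem pderiv_comm {σ : Type*} (i j : σ) (P : MvPolynomial σ ℝ) :
    pderiv i (pderiv j P) = pderiv j (pderiv i P) := by
  classical
  have h : ⁅pderiv (R := ℝ) i, pderiv (R := ℝ) j⁆ = 0 := by
    apply derivation_ext
    intro k
    simp [Derivation.commutator_apply, pderiv_X, Pi.single_apply, apply_ite]
  have := DFunLike.congr_fun h P
  rw [Derivation.commutator_apply] at this
  exact sub_eq_zero.1 this

section Calculus

variable (f : P3) (u v : VP3)

theorem pcross_zero : pcross u v 0 = u 1 * v 2 - u 2 * v 1 := rfl

theorem pcross_one : pcross u v 1 = u 2 * v 0 - u 0 * v 2 := rfl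

theorem pcross_two : pcross u v 2 = u 0 * v 1 - u 1 * v 0 := rfl

theorem pdiv_pcurl : pdiv (pcurl u) = 0 := by
  have h : pdiv (pcurl u) = pderiv 0 (pderiv 1 (u 2) - pderiv 2 (u 1)) +
      pderiv 1 (pderiv 2 (u 0) - pderiv 0 (u 2)) +
      pderiv 2 (pderiv 0 (u 1) - pderiv 1 (u 0)) := Fin.sum_univ_three _
  rw [h]
  simp only [map_sub]
  rw [pderiv_comm 1 0, pderiv_comm 2 0, pderiv_comm 2 1]
  ring

theorem pdiv_sub : pdiv (u - v) = pdiv u - pdiv v := by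
  simp [pdiv]

theorem pcurl_add : pcurl (u + v) = pcurl u + pcurl v := by
  ext1 c
  simp only [pcurl, Pi.add_apply, map_add]
  ring

theorem pcurl_mul : pcurl (fun c => f * u c) = fun c => pcross (pgrad f) u c + f * pcurl u c := by
  ext1 c
  simp only [pcurl, pcross, pgrad, Derivation.leibniz, smul_eq_mul]
  ring

theorem pgrad_pow (k : ℕ) (c : Fin 3) :
    pgrad (f ^ (k + 1)) c = (k + 1 : ℕ) * f ^ k * pgrad f c := by
  rw [pgrad, pderiv_pow, Nat.add_sub_cancel]
  rfl

theorem pcurl_pow_mul (k : ℕ) (c : Fin 3) : pcurl (fun c => f ^ (k + 1) * u c) c =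
    f ^ k * ((k + 1 : ℕ) * pcross (pgrad f) u c + f * pcurl u c) := by
  rw [pcurl_mul]
  simp only [pcross, pgrad_pow]
  ring

theorem pdiv_pow_mul (k : ℕ) : pdiv (fun c => f ^ (k + 1) * u c) =
    f ^ k * ((k + 1 : ℕ) * ∑ c, pgrad f c * u c + f * pdiv u) := by
  simp only [pdiv, Derivation.leibniz, smul_eq_mul, Fin.sum_univ_three]
  have := pgrad_pow f k
  simp only [pgrad] at this ⊢
  rw [this, this, this]
  ring

theorem totalDegree_pcurl_le {r : ℕ} (hu : ∀ c, (u c).totalDegree ≤ r + 1) (c : Fin 3) :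
    (pcurl u c).totalDegree ≤ r :=
  (totalDegree_sub _ _).trans (max_le (totalDegree_pderiv_le _ _ (hu _))
    (totalDegree_pderiv_le _ _ (hu _)))

end Calculus

theorem pgrad_baryPoly (x n : Fin 4 → V3) (i : Fin 4) :
    pgrad (baryPoly x n i) = fun c => C (n i c) := by
  ext1 c
  exact pderiv_affPoly _ _ _

theorem pgrad_baryPoly_sub (x n : Fin 4 → V3) (i j : Fin 4) :
    pgrad (baryPoly x n i - baryPoly x n j) = fun c => C (n i c) - C (n j c) := by
  ext1 c
  rw [baryPoly_sub, pgrad, pderiv_affPoly, Pi.sub_apply, C_sub]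

theorem baryPoly_ne_zero (h : IsFrame x n) (i : Fin 4) : baryPoly x n i ≠ 0 :=
  affPoly_ne_zero _ (h.ne_zero i)

theorem add_totalDegree_le_of_baryPoly_pow_mul (h : IsFrame x n) (i : Fin 4) (k : ℕ) {P : P3}
    (hP : P ≠ 0) : k + P.totalDegree ≤ (baryPoly x n i ^ k * P).totalDegree := by
  induction k with
  | zero => simp
  | succ k ih =>
    have h1 := one_le_totalDegree_affPoly (1 - n i ⬝ᵥ bary x) (h.ne_zero i)
    rw [← baryPoly] at h1
    rw [pow_succ', mul_assoc, totalDegree_mul_of_isDomain (baryPoly_ne_zero h i)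
      (mul_ne_zero (pow_ne_zero _ (baryPoly_ne_zero h i)) hP)]
    omega

/-- One step of the reduction: a field divisible by `μ_i ^ (s + 1)` on each piece is, up to the
curl of a field divisible by `μ_i ^ (s + 2)`, divisible by `μ_i ^ (s + 2)`. -/
theorem exists_reduction (h : IsFrame x n) {r s : ℕ} (hs : s < r) (R : Fin 4 → VP3)
    (h1 : ∀ i c, baryPoly x n i ∣ R i c)
    (h2 : ∀ i j, i ≠ j → baryPoly x n i - baryPoly x n j ∣
      ∑ c, (R i c - R j c) * C (n i c - n j c))
    (h3 : ∀ i, pdiv (fun c => baryPoly x n i ^ s * R i c) = 0)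
    (h4 : ∀ i c, (baryPoly x n i ^ s * R i c).totalDegree ≤ r) :
    ∃ w R' : Fin 4 → VP3,
      (∀ i c, (baryPoly x n i ^ (s + 2) * w i c).totalDegree ≤ r + 1) ∧
      (∀ i j, i ≠ j → ∀ c, baryPoly x n i - baryPoly x n j ∣ w i c - w j c) ∧
      (∀ i c, baryPoly x n i ^ (s + 1) * R' i c =
        baryPoly x n i ^ s * R i c - pcurl (fun c => baryPoly x n i ^ (s + 2) * w i c) c) ∧
      (∀ i c, baryPoly x n i ∣ R' i c) ∧
      (∀ i j, i ≠ j → baryPoly x n i - baryPoly x n j ∣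
        ∑ c, (R' i c - R' j c) * C (n i c - n j c)) := by
  choose g hg using h1
  have hgdeg : ∀ i c, (g i c).totalDegree ≤ r - s - 1 := by
    intro i c
    by_cases h0 : g i c = 0
    · simp [h0]
    · have h5 := add_totalDegree_le_of_baryPoly_pow_mul h i (s + 1) h0
      have h6 := h4 i c
      rw [pow_succ, mul_assoc, ← hg] at h5
      omega
  have hgN : ∀ i j, i ≠ j → baryPoly x n i - baryPoly x n j ∣
      ∑ c, (g i c - g j c) * C (n i c - n j c) := by
    intro i j hij
    have h5 : baryPoly x n i - baryPoly x n j ∣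
        baryPoly x n i * ∑ c, (g i c - g j c) * C (n i c - n j c) := by
      have h6 : baryPoly x n i * ∑ c, (g i c - g j c) * C (n i c - n j c) =
          ∑ c, (R i c - R j c) * C (n i c - n j c) -
          (baryPoly x n i - baryPoly x n j) * ∑ c, g j c * C (n i c - n j c) := by
        simp only [hg, Fin.sum_univ_three]
        ring
      rw [h6]
      exact dvd_sub (h2 i j hij) (dvd_mul_right _ _)
    rw [baryPoly_sub] at h5 ⊢
    refine affPoly_dvd_of_dvd_mul (h.sub_ne_zero hij) (y := bary x) ?_ ?_ h5
    · rw [sub_dotProduct]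
      ring
    · rw [eval_baryPoly_bary]
      exact one_ne_zero
  have hgD : ∀ i, baryPoly x n i ∣ ∑ c, C (n i c) * g i c := by
    intro i
    have h5 : pdiv (fun c => baryPoly x n i ^ (s + 1) * g i c) = 0 := by
      rw [← h3 i]
      simp only [hg, pow_succ, mul_assoc]
    rw [pdiv_pow_mul, pgrad_baryPoly] at h5
    have h6 := (mul_eq_zero.1 h5).resolve_left (pow_ne_zero _ (baryPoly_ne_zero h i))
    have h7 : baryPoly x n i ∣ ((s + 1 : ℕ) : P3) * ∑ c, C (n i c) * g i c :=
      ⟨-pdiv (g i), by linear_combination h6⟩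
    have h8 : IsUnit ((s + 1 : ℕ) : P3) := by
      rw [← map_natCast (C : ℝ →+* P3)]
      exact (isUnit_iff_ne_zero.2 (Nat.cast_ne_zero.2 s.succ_ne_zero)).map C
    exact h8.dvd_mul_left.1 h7
  obtain ⟨W, hW, hWg⟩ := exists_tangential_lift h g hgdeg hgN hgD
  let L : Fin 4 → Fin 4 → P3 := fun i m => C (1 / 4) * (baryPoly x n m - baryPoly x n i)
  have hL : ∀ i m, (L i m).totalDegree ≤ 1 := fun i m =>
    (totalDegree_mul _ _).trans (by
      rw [totalDegree_C, zero_add, baryPoly_sub]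
      exact totalDegree_affPoly_le _ _)
  let w : Fin 4 → VP3 := fun i c => C (1 / (s + 2 : ℝ)) * bind₁ (L i) (W c)
  have hw : ∀ i j c, baryPoly x n i - baryPoly x n j ∣ w i c - w j c := by
    intro i j c
    rw [← mul_sub]
    refine Dvd.dvd.mul_left (dvd_bind₁_sub_bind₁ _ _ _ (fun m => ?_) _) _
    exact ⟨C (-(1 / 4)), by simp only [L, C_neg]; ring⟩
  refine ⟨w, fun i c => g i c - (((s + 1 + 1 : ℕ) : P3) * pcross (pgrad (baryPoly x n i)) (w i) c +
    baryPoly x n i * pcurl (w i) c), fun i c => ?_, fun i j _ => hw i j, fun i c => ?_,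
    fun i c => ?_, fun i j hij => ?_⟩
  · have h5 : (w i c).totalDegree ≤ r - s - 1 := by
      refine (totalDegree_mul _ _).trans ?_
      rw [totalDegree_C, zero_add]
      exact (totalDegree_bind₁_le _ (hL i) _).trans (hW c).totalDegree_le
    have h6 : (baryPoly x n i ^ (s + 2)).totalDegree ≤ (s + 2) * 1 :=
      (totalDegree_pow _ _).trans (Nat.mul_le_mul_left _ (totalDegree_affPoly_le _ _))
    refine (totalDegree_mul _ _).trans ?_
    omega
  · rw [pcurl_pow_mul, hg]
    ring
  · refine baryPoly_dvd_of_bdryFace h i fun y hy => ?_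
    obtain ⟨hy0, hy1⟩ := eval_baryPoly_of_mem_bdryFace h hy
    have h5 := congrFun (hWg i (fun m => eval y (baryPoly x n m) / 4)
      (fun m => div_nonneg (hy1 m) (by norm_num)) (by simp [hy0]) (sum_eval_baryPoly h y)) c
    rw [← eq_sum_baryPoly h y] at h5
    have h6 : ∀ c, eval y (w i c) =
        1 / (s + 2 : ℝ) * eval (fun m => eval y (baryPoly x n m) / 4) (W c) := by
      intro c
      simp only [w, L, map_mul, eval_C, eval_bind₁, map_sub, hy0]
      congr 3
      ext m
      ring
    simp only [map_sub, map_add, map_mul, hy0, zero_mul, add_zero, pcross, pgrad_baryPoly, eval_C,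
      h6, map_natCast]
    simp only [cross3, evalV] at h5
    rw [← h5]
    push_cast
    field_simp
    ring
  · choose t ht using hw i j
    have h5 : w i = w j + fun c => (baryPoly x n i - baryPoly x n j) * t c := by
      ext1 c
      rw [Pi.add_apply, ← ht]
      ring
    obtain ⟨G, hG⟩ := hgN i j hij
    beta_reduce
    rw [h5, pcurl_add, pcurl_mul (baryPoly x n i - baryPoly x n j) t, pgrad_baryPoly_sub,
      pgrad_baryPoly, pgrad_baryPoly]
    refine ⟨G - (((s + 1 + 1 : ℕ) : P3) * ∑ c, pcross (fun c => C (n i c)) t c * C (n i c - n j c) +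
      ∑ c, pcurl (w j) c * C (n i c - n j c) +
      baryPoly x n i * ∑ c, pcurl t c * C (n i c - n j c)), ?_⟩
    rw [mul_sub, ← hG]
    simp only [Fin.sum_univ_three, Pi.add_apply, pcross_zero, pcross_one, pcross_two, C_sub]
    ring

/-- Iterating the reduction: a divergence-free field `μ_i ^ s * R i` with the right divisibility
properties is the curl of a continuous field vanishing on the boundary. -/
theorem exists_vanishing_potential (h : IsFrame x n) (r k : ℕ) :
    ∀ (s : ℕ), r ≤ s + k → ∀ R : Fin 4 → VP3,
    (∀ i c, baryPoly x n i ∣ R i c) →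
    (∀ i j, i ≠ j → baryPoly x n i - baryPoly x n j ∣
      ∑ c, (R i c - R j c) * C (n i c - n j c)) →
    (∀ i, pdiv (fun c => baryPoly x n i ^ s * R i c) = 0) →
    (∀ i c, (baryPoly x n i ^ s * R i c).totalDegree ≤ r) →
    ∃ q : Fin 4 → VP3, (∀ i c, (q i c).totalDegree ≤ r + 1) ∧
      (∀ i j, i ≠ j → ∀ c, baryPoly x n i - baryPoly x n j ∣ q i c - q j c) ∧
      (∀ i c, baryPoly x n i ∣ q i c) ∧
      ∀ i c, pcurl (q i) c = baryPoly x n i ^ s * R i c := by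
  induction k with
  | zero =>
    intro s hs R h1 _ _ h4
    have hR : ∀ i c, R i c = 0 := by
      intro i c
      obtain ⟨P, hP⟩ := h1 i c
      by_contra h0
      have hP0 : P ≠ 0 := by
        rintro rfl
        exact h0 (by rw [hP, mul_zero])
      have h5 := add_totalDegree_le_of_baryPoly_pow_mul h i (s + 1) hP0
      have h6 := h4 i c
      rw [pow_succ, mul_assoc, ← hP] at h5
      omega
    exact ⟨0, by simp, by simp, by simp, by simp [pcurl, hR]⟩
  | succ k ih =>
    intro s hs R h1 h2 h3 h4
    rcases le_or_gt r s with hrs | hrs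
    · exact ih s (by omega) R h1 h2 h3 h4
    obtain ⟨w, R', hw, hwl, hR, hR1, hR2⟩ := exists_reduction h hrs R h1 h2 h3 h4
    obtain ⟨q, hq, hql, hqμ, hqc⟩ := ih (s + 1) (by omega) R' hR1 hR2 (by
      intro i
      have : (fun c => baryPoly x n i ^ (s + 1) * R' i c) =
          (fun c => baryPoly x n i ^ s * R i c) -
            pcurl (fun c => baryPoly x n i ^ (s + 2) * w i c) := by
        ext1 c
        exact hR i c
      rw [this, pdiv_sub, h3, pdiv_pcurl, sub_zero]) (by
      intro i c
      rw [hR]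
      exact (totalDegree_sub _ _).trans (max_le (h4 i c) (totalDegree_pcurl_le _ (hw i) c)))
    refine ⟨fun i => q i + fun c => baryPoly x n i ^ (s + 2) * w i c, fun i c => ?_,
      fun i j hij c => ?_, fun i c => ?_, fun i c => ?_⟩
    · exact (totalDegree_add _ _).trans (max_le (hq i c) (hw i c))
    · obtain ⟨a, ha⟩ := hql i j hij c
      obtain ⟨b, hb⟩ := hwl i j hij c
      obtain ⟨d, hd⟩ := sub_dvd_pow_sub_pow (baryPoly x n i) (baryPoly x n j) (s + 2)
      refine ⟨a + d * w i c + baryPoly x n j ^ (s + 2) * b, ?_⟩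
      simp only [Pi.add_apply]
      linear_combination ha + w i c * hd + baryPoly x n j ^ (s + 2) * hb
    · exact dvd_add (hqμ i c) (Dvd.dvd.mul_right (dvd_pow_self _ (by omega)) _)
    · rw [pcurl_add, Pi.add_apply, hqc, hR]
      ring

end Alfeld

/-- a continuous, divergence-free piecewise polynomial vector field vanishing on
the boundary of an Alfeld split is the curl of a piecewise polynomial field which, together
with its curl, is continuous and vanishes on the boundary. -/
theorem statement5 (r : ℕ) (x : Fin 4 → V3) (hx : AffineIndependent ℝ x)
    (p : Fin 4 → VP3) (hdeg : ∀ i, degVle (p i) r)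
    (hcont : ∀ i j, i ≠ j → ∀ y ∈ intFace x i j, evalV (p i) y = evalV (p j) y)
    (hbdry : ∀ i, ∀ y ∈ bdryFace x i, evalV (p i) y = 0)
    (hdiv : ∀ i, pdiv (p i) = 0) :
    ∃ q : Fin 4 → VP3,
      (∀ i, degVle (q i) (r + 1)) ∧
      (∀ i j, i ≠ j → ∀ y ∈ intFace x i j, evalV (q i) y = evalV (q j) y) ∧
      (∀ i j, i ≠ j → ∀ y ∈ intFace x i j,
        evalV (pcurl (q i)) y = evalV (pcurl (q j)) y) ∧
      (∀ i, ∀ y ∈ bdryFace x i, evalV (q i) y = 0 ∧ evalV (pcurl (q i)) y = 0) ∧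
      (∀ i, pcurl (q i) = p i) := by
  obtain ⟨n, h⟩ := exists_isFrame hx
  obtain ⟨q, hq, hql, hqμ, hqc⟩ := exists_vanishing_potential h r r 0 (by omega) p
    (fun i c => baryPoly_dvd_of_bdryFace h i fun y hy => congrFun (hbdry i y hy) c)
    (fun i j hij => Finset.dvd_sum fun c _ => Dvd.dvd.mul_right
      (baryPoly_sub_dvd_of_intFace h hij fun y hy => by
        rw [map_sub, sub_eq_zero]
        exact congrFun (hcont i j hij y hy) c) _)
    (fun i => by simpa using hdiv i) (fun i c => by simpa using hdeg i c)
  have hcurl : ∀ i, pcurl (q i) = p i := fun i => funext fun c => by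
    rw [hqc, pow_zero, one_mul]
  refine ⟨q, hq, fun i j hij y hy => funext fun c => ?_, fun i j hij y hy => ?_,
    fun i y hy => ⟨funext fun c => ?_, ?_⟩, hcurl⟩
  · obtain ⟨Q, hQ⟩ := hql i j hij c
    have := congrArg (eval y) hQ
    rwa [map_mul, map_sub, map_sub, eval_baryPoly_of_mem_intFace h hy, sub_self, zero_mul,
      sub_eq_zero] at this
  · rw [hcurl, hcurl, hcont i j hij y hy]
  · obtain ⟨Q, hQ⟩ := hqμ i c
    have := congrArg (eval y) hQ
    rwa [map_mul, (eval_baryPoly_of_mem_bdryFace h hy).1, zero_mul] at this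
  · rw [hcurl, hbdry i y hy]
end
end

section
/- Let T = [x₀,x₁,x₂,x₃] be a tetrahedron in ℝ³ with affinely independent vertices, and let λ₀,…,λ₃ be its barycentric coordinates, i.e. the affine maps λ_i : ℝ³ → ℝ with λ_i(x_j) = δ_{ij}. Fix i ∈ {0,1,2,3} and let F_i = conv{x_j : j ≠ i} be the face opposite x_i. Suppose ω : ℝ³ → ℝ³ is a polynomial map of total degree ≤ r whose normal component vanishes on F_i, i.e. ω(x) · ∇λ_i = 0 for every x ∈ F_i. Then there exist polynomial maps v : ℝ³ → ℝ³ of degree ≤ r and w : ℝ³ → ℝ³ of degree ≤ r−1 (with w = 0 if r = 0) such that ω = ∇λ_i × v + λ_i w. -/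
open MvPolynomial Matrix

noncomputable section

open Alfeld

open Topology

namespace MvPolynomial

variable {σ R : Type*} [CommRing R]

/-- A polynomial of total degree at most one is affine. -/
theorem eq_C_add_sum_of_totalDegree_le_one [Fintype σ] {p : MvPolynomial σ R}
    (hp : p.totalDegree ≤ 1) :
    p = C (coeff 0 p) + ∑ c, C (coeff (Finsupp.single c 1) p) * X c := by
  classical
  ext m
  rcases lt_trichotomy m.degree 1 with h | h | h
  · obtain rfl : m = 0 := (Finsupp.degree_eq_zero_iff m).1 (by lia)
    simp [coeff_sum, coeff_C_mul, coeff_X]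
  · obtain ⟨c, rfl⟩ : m ∈ Set.range (fun a : σ ↦ Finsupp.single a 1) := by
      rw [Finsupp.range_single_one]; exact h
    simp [coeff_sum, coeff_C_mul, coeff_X, coeff_C, Finsupp.single_left_inj,
      (Finsupp.single_ne_zero.2 one_ne_zero).symm]
  · have hm : m ≠ 0 := by rintro rfl; simp at h
    have hs : ∀ c, Finsupp.single c 1 ≠ m := by rintro c rfl; simp at h
    rw [coeff_eq_zero_of_totalDegree_lt (lt_of_le_of_lt hp h)]
    simp [coeff_sum, coeff_C_mul, coeff_X, coeff_C, hm.symm, hs]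

/-- A polynomial vanishing at the points `y - p(y) u` for all `y` is divisible by `p`. -/
theorem dvd_of_eval_sub_smul_eq_zero [IsDomain R] [Infinite R] {p q : MvPolynomial σ R}
    (u : σ → R) (h : ∀ y : σ → R, eval (y - eval y p • u) q = 0) : p ∣ q := by
  have h0 : aeval (fun c => X c - p * C (u c)) q = 0 := by
    refine funext fun y => ?_
    have hcomp : (aeval y).comp (aeval fun c => X c - p * C (u c)) =
        aeval (R := R) (y - eval y p • u) := by
      refine algHom_ext fun c => ?_
      simp [aeval_eq_eval]
    simpa [aeval_eq_eval, h y] using DFunLike.congr_fun hcomp q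
  have h1 : (Ideal.Quotient.mkₐ R (Ideal.span {p})).comp (aeval fun c => X c - p * C (u c)) =
      Ideal.Quotient.mkₐ R (Ideal.span {p}) := by
    refine algHom_ext fun c => ?_
    rw [AlgHom.comp_apply, aeval_X, Ideal.Quotient.mkₐ_eq_mk, Ideal.Quotient.eq,
      Ideal.mem_span_singleton]
    exact ⟨-C (u c), by ring⟩
  have h2 := DFunLike.congr_fun h1 q
  rw [AlgHom.comp_apply, h0, map_zero] at h2
  exact Ideal.mem_span_singleton.1 (Ideal.Quotient.eq_zero_iff_mem.1 h2.symm)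

/-- A real polynomial vanishing along a line near one point vanishes on the whole line. -/
theorem eval_add_eq_zero_of_eventually {p : MvPolynomial σ ℝ} (b d : σ → ℝ)
    (h : ∀ᶠ t in 𝓝 (0 : ℝ), eval (b + t • d) p = 0) (t : ℝ) : eval (b + t • d) p = 0 := by
  set P : Polynomial ℝ := aeval (fun c => Polynomial.C (b c) + Polynomial.X * Polynomial.C (d c)) p
  have hP : ∀ s : ℝ, P.eval s = eval (b + s • d) p := by
    intro s
    have : (Polynomial.aeval s).comp
        (aeval fun c => Polynomial.C (b c) + Polynomial.X * Polynomial.C (d c)) =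
        aeval (R := ℝ) (b + s • d) := by
      refine algHom_ext fun c => ?_
      simp only [AlgHom.comp_apply, aeval_X, map_add, map_mul, Polynomial.coe_aeval_eq_eval,
        Polynomial.eval_C, Polynomial.eval_X, Pi.add_apply, Pi.smul_apply, smul_eq_mul]
    have := DFunLike.congr_fun this p
    simpa [P, aeval_eq_eval] using this
  have : P = 0 := by
    refine Polynomial.eq_zero_of_infinite_isRoot P (infinite_of_mem_nhds (0 : ℝ) ?_)
    filter_upwards [h] with s hs
    simpa [Polynomial.IsRoot, hP] using hs
  rw [← hP, this, Polynomial.eval_zero]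

end MvPolynomial

namespace Alfeld

/-- A polynomial vanishing on a face of a tetrahedron vanishes on the plane of that face. -/
theorem eval_eq_zero_of_bdryFace {x : Fin 4 → V3} {i : Fin 4} {q : P3}
    (hq : ∀ y ∈ bdryFace x i, eval y q = 0) {μ : Fin 4 → ℝ} (hμ : ∑ j, μ j = 1) (hi : μ i = 0) :
    eval (∑ j, μ j • x j) q = 0 := by
  set ν : Fin 4 → ℝ := fun j => if j = i then 0 else 3⁻¹ with hν
  have hν1 : ∑ j, ν j = 1 := by
    rw [← Finset.add_sum_erase _ _ (Finset.mem_univ i)]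
    simp +contextual [hν, Finset.sum_ite, Finset.filter_ne', Finset.filter_eq']
  have key := eval_add_eq_zero_of_eventually (p := q) (∑ j, ν j • x j)
    (∑ j, (μ j - ν j) • x j) ?_ 1
  · rw [one_smul, ← Finset.sum_add_distrib] at key
    simpa [← add_smul] using key
  have hpos : ∀ᶠ t in 𝓝 (0 : ℝ), ∀ j, 0 ≤ ν j + t * (μ j - ν j) := by
    refine Filter.eventually_all.2 fun j => ?_
    by_cases hj : j = i
    · simp [hν, hj, hi]
    · have hc : ContinuousAt (fun t : ℝ => ν j + t * (μ j - ν j)) 0 := by fun_prop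
      refine (hc.eventually_const_lt (u := 0) ?_).mono fun t => le_of_lt
      simp [hν, hj]
  filter_upwards [hpos] with t ht
  apply hq
  have : ∑ j, ν j • x j + t • ∑ j, (μ j - ν j) • x j =
      ∑ j ∈ Finset.univ.erase i, (ν j + t * (μ j - ν j)) • x j := by
    rw [Finset.smul_sum, ← Finset.sum_add_distrib, ← Finset.add_sum_erase _ _ (Finset.mem_univ i)]
    simp [hν, hi, smul_smul, add_smul]
  rw [this]
  refine (convex_convexHull ℝ _).sum_mem (fun j _ => ht j) ?_ fun j hj =>
    subset_convexHull ℝ _ ⟨j, by simpa using hj, rfl⟩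
  have h := Finset.add_sum_erase Finset.univ (fun j => ν j + t * (μ j - ν j)) (Finset.mem_univ i)
  have h' : ∑ j, (ν j + t * (μ j - ν j)) = 1 := by
    rw [Finset.sum_add_distrib, ← Finset.mul_sum, Finset.sum_sub_distrib, hμ, hν1]
    ring
  have hi' : ν i + t * (μ i - ν i) = 0 := by simp [hν, hi]
  rwa [h', hi', zero_add] at h

/-- A polynomial vanishing on a face of a tetrahedron is divisible by the barycentric coordinate
which vanishes on that face. -/
theorem dvd_of_eval_bdryFace_eq_zero {x : Fin 4 → V3} (hx : AffineIndependent ℝ x) {i : Fin 4}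
    {lam : P3} {a : ℝ} {g : V3} (hform : ∀ y, eval y lam = a + g ⬝ᵥ y) (hg : g ⬝ᵥ g ≠ 0)
    (hlam : ∀ j, eval (x j) lam = if j = i then 1 else 0) {q : P3}
    (hq : ∀ y ∈ bdryFace x i, eval y q = 0) : lam ∣ q := by
  refine dvd_of_eval_sub_smul_eq_zero ((g ⬝ᵥ g)⁻¹ • g) fun y => ?_
  set z := y - eval y lam • (g ⬝ᵥ g)⁻¹ • g with hz
  have hz0 : eval z lam = 0 := by
    rw [hform z, hz, dotProduct_sub, dotProduct_smul, dotProduct_smul, hform y]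
    simp only [smul_eq_mul]
    field_simp
    ring
  let b : AffineBasis (Fin 4) ℝ V3 :=
    ⟨x, hx, by rw [hx.affineSpan_eq_top_iff_card_eq_finrank_add_one]; simp⟩
  have hsum : ∑ j, b.coord j z = 1 := b.sum_coord_apply_eq_one z
  have hcomb : ∑ j, b.coord j z • x j = z := b.linear_combination_coord_eq_self z
  rw [← hcomb]
  refine eval_eq_zero_of_bdryFace hq hsum ?_
  have : ∑ j, b.coord j z * eval (x j) lam = 0 := by
    rw [← hz0]
    conv_rhs => rw [← hcomb]
    simp only [hform, dotProduct_sum, dotProduct_smul, mul_add, Finset.sum_add_distrib,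
      ← Finset.sum_mul, hsum, smul_eq_mul, one_mul]
  simpa [hlam] using this

end Alfeld

/-- if a polynomial vector field of degree at most `r` has vanishing normal
component on the face `F_i` of a tetrahedron, then it can be written as
`∇λ_i × v + λ_i w` with `deg v ≤ r` and `deg w ≤ r - 1` (`w = 0` if `r = 0`). -/
theorem statement6 (r : ℕ) (x : Fin 4 → V3) (hx : AffineIndependent ℝ x)
    (i : Fin 4) (lam : P3) (hlamdeg : lam.totalDegree ≤ 1)
    (hlam : ∀ j, eval (x j) lam = if j = i then 1 else 0)
    (om : VP3) (hdeg : degVle om r)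
    (hnormal : ∀ y ∈ bdryFace x i, evalV om y ⬝ᵥ evalV (pgrad lam) y = 0) :
    ∃ v w : VP3,
      degVle v r ∧ degVle w (r - 1) ∧ (r = 0 → w = 0) ∧
      om = pcross (pgrad lam) v + fun c => lam * w c := by
  set g : V3 := fun c => coeff (Finsupp.single c 1) lam with hg_def
  have hlam_eq := eq_C_add_sum_of_totalDegree_le_one hlamdeg
  have hform : ∀ y, eval y lam = coeff 0 lam + g ⬝ᵥ y := by
    intro y
    conv_lhs => rw [hlam_eq]
    simp [dotProduct, hg_def]
  have hgrad : ∀ c, pgrad lam c = C (g c) := by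
    intro c
    rw [pgrad]
    conv_lhs => rw [hlam_eq]
    simp [hg_def, pderiv_X, Pi.single_apply]
  have hg : g ≠ 0 := by
    intro h0
    obtain ⟨j, hj⟩ : ∃ j, j ≠ i := exists_ne i
    have h1 := hlam i
    have h2 := hlam j
    rw [hform, h0] at h1 h2
    simp [hj] at h1 h2
    linarith
  have hgg : g ⬝ᵥ g ≠ 0 := mt dotProduct_self_eq_zero.1 hg
  have hlam0 : lam ≠ 0 := by
    rintro rfl
    simpa using hlam i
  have hlam1 : lam.totalDegree ≠ 0 := by
    intro h
    rw [totalDegree_eq_zero_iff_eq_C] at h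
    refine hg (_root_.funext fun c => ?_)
    rw [hg_def, h]
    simp [coeff_C, (Finsupp.single_ne_zero.2 one_ne_zero).symm]
  set q : P3 := ∑ c, C (g c) * om c with hq_def
  have hCdeg : ∀ (a : ℝ) (p : P3), (C a * p).totalDegree ≤ p.totalDegree := fun a p =>
    (totalDegree_mul _ _).trans (by simp)
  have hqdeg : q.totalDegree ≤ r :=
    totalDegree_finsetSum_le fun c _ => (hCdeg _ _).trans (hdeg c)
  obtain ⟨s, hs⟩ : lam ∣ q := by
    refine dvd_of_eval_bdryFace_eq_zero hx hform hgg hlam fun y hy => ?_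
    rw [← hnormal y hy]
    simp [hq_def, evalV, dotProduct, hgrad, mul_comm]
  have hsdeg : s ≠ 0 → s.totalDegree + 1 ≤ r := by
    intro hs0
    rw [hs, totalDegree_mul_of_isDomain hlam0 hs0] at hqdeg
    lia
  have hk : (C (g ⬝ᵥ g)⁻¹ : P3) * ∑ c, C (g c) * C (g c) = 1 := by
    simp only [← C_mul, ← map_sum]
    rw [← C_1]
    exact congrArg C (inv_mul_cancel₀ hgg)
  refine ⟨fun c => -(C (g ⬝ᵥ g)⁻¹ * (C (g (c + 1)) * om (c + 2) - C (g (c + 2)) * om (c + 1))),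
    fun c => C (g ⬝ᵥ g)⁻¹ * (C (g c) * s), fun c => ?_, fun c => ?_, fun hr => ?_, ?_⟩
  · rw [totalDegree_neg]
    exact (hCdeg _ _).trans ((totalDegree_sub _ _).trans
      (max_le ((hCdeg _ _).trans (hdeg _)) ((hCdeg _ _).trans (hdeg _))))
  · refine (hCdeg _ _).trans ((hCdeg _ _).trans ?_)
    rcases eq_or_ne s 0 with rfl | hs0
    · simp
    · have := hsdeg hs0
      lia
  · obtain rfl : s = 0 := by
      by_contra hs0
      have := hsdeg hs0
      lia
    ext1 c
    simp
  · ext1 c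
    simp only [Pi.add_apply, pcross, hgrad]
    rw [hq_def] at hs
    rw [Fin.sum_univ_three] at hs hk
    fin_cases c <;> simp
    · linear_combination -om 0 * hk + C (g ⬝ᵥ g)⁻¹ * C (g 0) * hs
    · linear_combination -om 1 * hk + C (g ⬝ᵥ g)⁻¹ * C (g 1) * hs
    · linear_combination -om 2 * hk + C (g ⬝ᵥ g)⁻¹ * C (g 2) * hs
end
end

section
/- Let r ≥ 0 be an integer and let (p₀,p₁,p₂,p₃) be a piecewise polynomial vector field of degree ≤ r on the Alfeld split T^z of a tetrahedron T ⊂ ℝ³ whose normal component is single-valued across interior faces ((p_i − p_j) · n_{ij} = 0 on F_{ij} for all i ≠ j) and whose normal trace vanishes on the boundary (p_i · n_i = 0 on F_i for each i). Then there exist a piecewise polynomial vector field (v₀,v₁,v₂,v₃) of degree ≤ r and a piecewise polynomial vector field (w₀,w₁,w₂,w₃) of degree ≤ r−1 (the w_i being 0 if r = 0) such that p_i = 4∇λ_i × v_i + 4λ_i w_i for each i, where λ_i is the barycentric coordinate of T associated with x_i. Moreover, the tangential component of v along each edge of T is single-valued: for every edge e = conv{x_k, x_l} of T (k ≠ l)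 and for the two indices i, j ∉ {k,l}, one has (v_i(x) − v_j(x)) · (x_l − x_k) = 0 for every x ∈ e. -/
open MvPolynomial Matrix

noncomputable section

open Alfeld

namespace Alfeld

/-- A polynomial of total degree at most one is affine. -/
theorem exists_eq_affine {σ R : Type*} [Fintype σ] [CommSemiring R] (f : MvPolynomial σ R)
    (hf : f.totalDegree ≤ 1) : ∃ (g : σ → R) (b : R), f = C b + ∑ c, C (g c) * X c := by
  classical
  refine ⟨fun c => coeff (Finsupp.single c 1) f, coeff 0 f, ?_⟩
  ext m
  simp only [coeff_add, coeff_C, coeff_sum, coeff_C_mul, coeff_X, mul_ite, mul_one, mul_zero]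
  by_cases h0 : m = 0
  · subst h0
    simp
  by_cases h1 : ∃ c, m = Finsupp.single c 1
  · obtain ⟨c, rfl⟩ := h1
    simp [Finsupp.single_left_inj, h0, eq_comm]
  · push Not at h1
    have hm : coeff m f = 0 := by
      apply coeff_eq_zero_of_totalDegree_lt
      have hd : 1 < m.degree := by
        by_contra hlt
        have hle : m.degree ≤ 1 := not_lt.mp hlt
        obtain ⟨c, hc⟩ := Finsupp.ne_iff.mp h0
        refine h1 c ?_
        have hs : m.degree = m c + ∑ d ∈ Finset.univ.erase c, m d := by
          rw [Finsupp.degree_eq_sum, ← Finset.add_sum_erase _ _ (Finset.mem_univ c)]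
        have hc' : m c ≠ 0 := by simpa using hc
        have hz : ∑ d ∈ Finset.univ.erase c, m d = 0 := by omega
        ext d
        by_cases hdc : d = c
        · subst hdc
          simp only [Finsupp.single_eq_same]
          omega
        · rw [Finsupp.single_eq_of_ne hdc]
          exact Finset.sum_eq_zero_iff.mp hz d (by simp [hdc])
      exact hf.trans_lt hd
    rw [hm, if_neg (Ne.symm h0), Finset.sum_eq_zero, add_zero]
    intro c _
    rw [if_neg (Ne.symm (h1 c))]

theorem eval_affine {σ R : Type*} [Fintype σ] [CommSemiring R] (g : σ → R) (b : R) (y : σ → R) :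
    eval y (C b + ∑ c, C (g c) * X c) = b + g ⬝ᵥ y := by
  simp [dotProduct]

/-- An affine polynomial divides every polynomial vanishing on its zero set. -/
theorem affine_dvd_of_forall_eval_eq_zero {σ K : Type*} [Fintype σ] [Field K] [Infinite K]
    {g : σ → K} {b : K} (hg : g ≠ 0) {f : MvPolynomial σ K}
    (hf : ∀ y, b + g ⬝ᵥ y = 0 → eval y f = 0) : (C b + ∑ c, C (g c) * X c) ∣ f := by
  classical
  obtain ⟨d, hd⟩ := Function.ne_iff.mp hg
  set l : MvPolynomial σ K := C b + ∑ c, C (g c) * X c with hl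
  let u : σ → K := Pi.single d (g d)⁻¹
  have hu : g ⬝ᵥ u = 1 := by simp [u, mul_inv_cancel₀ hd]
  let proj : σ → MvPolynomial σ K := fun c => X c - C (u c) * l
  have hproj : bind₁ proj f = 0 := by
    refine MvPolynomial.funext fun y => ?_
    rw [map_zero, eval, eval₂Hom_bind₁]
    refine hf _ ?_
    have he : (fun c => eval₂Hom (RingHom.id K) y (proj c)) = y - (b + g ⬝ᵥ y) • u := by
      ext c
      change eval y (proj c) = _
      simp only [proj, map_sub, map_mul, eval_X, eval_C, hl, eval_affine, Pi.sub_apply,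
        Pi.smul_apply, smul_eq_mul]
      ring
    rw [he, dotProduct_sub, dotProduct_smul, hu]
    simp
  have hmk : (Ideal.Quotient.mkₐ K (Ideal.span {l})).comp (bind₁ proj) =
      Ideal.Quotient.mkₐ K (Ideal.span {l}) := by
    refine MvPolynomial.algHom_ext fun c => ?_
    simp only [AlgHom.comp_apply, bind₁_X_right, Ideal.Quotient.mkₐ_eq_mk, proj]
    rw [Ideal.Quotient.eq, Ideal.mem_span_singleton]
    exact ⟨-C (u c), by ring⟩
  rw [← Ideal.mem_span_singleton, ← Ideal.Quotient.eq_zero_iff_mem]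
  have := DFunLike.congr_fun hmk f
  rw [AlgHom.comp_apply, hproj, map_zero] at this
  exact this.symm

/-- A polynomial vanishing on the convex hull of finitely many points vanishes on
their affine span. -/
theorem eval_sum_smul_eq_zero {σ ι : Type*} {f : MvPolynomial σ ℝ} {x : ι → σ → ℝ}
    {s : Finset ι} (hf : ∀ y ∈ convexHull ℝ (x '' s), eval y f = 0) {a : ι → ℝ}
    (ha : ∑ j ∈ s, a j = 1) : eval (∑ j ∈ s, a j • x j) f = 0 := by
  have hs : s.Nonempty := Finset.nonempty_of_sum_ne_zero (ha ▸ one_ne_zero)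
  have hcard : (0 : ℝ) < s.card := by exact_mod_cast hs.card_pos
  let wt : ℝ → ι → ℝ := fun t j => (1 - t) * (s.card : ℝ)⁻¹ + t * a j
  let q : Polynomial ℝ := f.eval₂ Polynomial.C fun c =>
    ∑ j ∈ s, ((1 - Polynomial.X) * Polynomial.C (s.card : ℝ)⁻¹ +
      Polynomial.X * Polynomial.C (a j)) * Polynomial.C (x j c)
  have hq : ∀ t, q.eval t = eval (∑ j ∈ s, wt t j • x j) f := by
    intro t
    rw [← Polynomial.coe_evalRingHom, MvPolynomial.hom_eval₂]
    congr 1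
    · ext; simp
    · ext c
      simp [wt, Finset.sum_apply, mul_comm (a _)]
  have hwt : ∀ t, ∑ j ∈ s, wt t j = 1 := by
    intro t
    simp only [wt, Finset.sum_add_distrib, Finset.sum_const, nsmul_eq_mul, ← Finset.mul_sum, ha]
    field_simp
    ring
  have hsmall : ∀ᶠ t in nhdsWithin (0 : ℝ) (Set.Ioi 0), q.IsRoot t := by
    have hpos : ∀ j ∈ s, ∀ᶠ t in nhdsWithin (0 : ℝ) (Set.Ioi 0), 0 < wt t j := by
      intro j _
      have hc : Continuous fun t => wt t j := by fun_prop
      exact nhdsWithin_le_nhds (hc.continuousAt.eventually_const_lt (by simpa [wt] using hs))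
    filter_upwards [(Finset.eventually_all s).mpr hpos] with t ht
    rw [Polynomial.IsRoot, hq]
    refine hf _ ((convex_convexHull ℝ _).sum_mem (fun j hj => (ht j hj).le) (hwt t) ?_)
    exact fun j hj => subset_convexHull ℝ _ ⟨j, hj, rfl⟩
  have hinf : Set.Infinite {t | q.IsRoot t} := by
    obtain ⟨e, he, hsub⟩ := mem_nhdsGT_iff_exists_Ioo_subset.mp hsmall
    exact (Set.Ioo_infinite he).mono hsub
  have h1 := hq 1
  rw [Polynomial.eq_zero_of_infinite_isRoot q hinf, Polynomial.eval_zero] at h1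
  simpa [wt] using h1.symm

/-- The points of `ℝ³` are affine combinations of the vertices of a tetrahedron. -/
theorem exists_weights {x : Fin 4 → V3} (hx : AffineIndependent ℝ x) (y : V3) :
    ∃ a : Fin 4 → ℝ, ∑ j, a j = 1 ∧ y = ∑ j, a j • x j := by
  have htop : affineSpan ℝ (Set.range x) = ⊤ := by
    rw [hx.affineSpan_eq_top_iff_card_eq_finrank_add_one]
    simp
  let B : AffineBasis (Fin 4) ℝ V3 := ⟨x, hx, htop⟩
  exact ⟨fun j => B.coord j y, B.sum_coord_apply_eq_one y,
    (B.linear_combination_coord_eq_self y).symm⟩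

theorem dotProduct_self_pos {g : V3} (hg : g ≠ 0) : 0 < g ⬝ᵥ g :=
  lt_of_le_of_ne (Finset.sum_nonneg fun c _ => mul_self_nonneg (g c))
    (Ne.symm (dotProduct_self_eq_zero.not.mpr hg))

theorem inv_sqrt_smul_dotProduct_self {g : V3} (hg : g ≠ 0) :
    ((√(g ⬝ᵥ g))⁻¹ • g) ⬝ᵥ ((√(g ⬝ᵥ g))⁻¹ • g) = 1 := by
  have h0 := dotProduct_self_pos hg
  rw [smul_dotProduct, dotProduct_smul, smul_smul, smul_eq_mul, ← mul_inv,
    Real.mul_self_sqrt h0.le, inv_mul_cancel₀ h0.ne']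

theorem dotProduct_eq_zero_of_unit {g A : V3} (hg : g ≠ 0)
    (h : A ⬝ᵥ ((√(g ⬝ᵥ g))⁻¹ • g) = 0) : A ⬝ᵥ g = 0 := by
  have h0 := dotProduct_self_pos hg
  rw [dotProduct_smul, smul_eq_mul] at h
  exact (mul_eq_zero.mp h).resolve_left (inv_ne_zero (Real.sqrt_ne_zero'.mpr h0))

/-- Two fields tangent to planes with normals `g` and `h`, with equal normal component across
the bisecting plane with normal `g - h`, have matching rotated components along the common
direction `t` of the planes. -/
theorem cross_dotProduct_eq {g h A B t : V3} (hN : g ⨯₃ h ≠ 0)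
    (hA : A ⬝ᵥ g = 0) (hB : B ⬝ᵥ h = 0) (hAB : (A - B) ⬝ᵥ (g - h) = 0)
    (hgt : g ⬝ᵥ t = 0) (hht : h ⬝ᵥ t = 0) :
    (g ⬝ᵥ g)⁻¹ * ((A ⨯₃ g) ⬝ᵥ t) = (h ⬝ᵥ h)⁻¹ * ((B ⨯₃ h) ⬝ᵥ t) := by
  have hg : g ⬝ᵥ g ≠ 0 := by
    rw [Ne, dotProduct_self_eq_zero]
    rintro rfl
    simp at hN
  have hh : h ⬝ᵥ h ≠ 0 := by
    rw [Ne, dotProduct_self_eq_zero]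
    rintro rfl
    simp at hN
  set N := g ⨯₃ h with hNdef
  have hNN : N ⬝ᵥ N ≠ 0 := by rwa [Ne, dotProduct_self_eq_zero]
  have hNt : N ⨯₃ t = 0 := by
    rw [hNdef, cross_cross_eq_smul_sub_smul, hgt, hht]
    simp
  have ht : (N ⬝ᵥ N) • t = (N ⬝ᵥ t) • N := by
    have := cross_cross_eq_smul_sub_smul' N N t
    rw [hNt, map_zero] at this
    exact (sub_eq_zero.mp this.symm).symm
  have hABN : (h ⬝ᵥ h) * ((A ⨯₃ g) ⬝ᵥ N) = (g ⬝ᵥ g) * ((B ⨯₃ h) ⬝ᵥ N) := by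
    rw [hNdef, cross_dot_cross, cross_dot_cross, hA, hB]
    rw [sub_dotProduct, dotProduct_sub, dotProduct_sub, hA, hB] at hAB
    linear_combination (g ⬝ᵥ g) * (h ⬝ᵥ h) * hAB
  have key : ∀ M : V3, (N ⬝ᵥ N) * (M ⬝ᵥ t) = (N ⬝ᵥ t) * (M ⬝ᵥ N) := by
    intro M
    have := congrArg (M ⬝ᵥ ·) ht
    simpa [dotProduct_smul] using this
  rw [inv_mul_eq_div, inv_mul_eq_div, div_eq_div_iff hg hh]
  apply mul_left_cancel₀ hNN
  linear_combination (h ⬝ᵥ h) * key (A ⨯₃ g) - (g ⬝ᵥ g) * key (B ⨯₃ h) + (N ⬝ᵥ t) * hABN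

theorem pcross_eq_crossProduct (u v : VP3) : pcross u v = u ⨯₃ v := by
  ext1 c
  fin_cases c <;> simp [pcross, cross_apply]

theorem pgrad_affine (g : V3) (b : ℝ) :
    pgrad (C b + ∑ c, C (g c) * X c) = fun c => C (g c) := by
  classical
  ext1 d
  simp [pgrad, Derivation.leibniz, pderiv_X, Pi.single_apply, eq_comm]

/-- Rotated tangential part of `p` relative to the constant normal `g`. -/
def tangentialPotential (g : V3) (p : VP3) : VP3 :=
  (C (4 * (g ⬝ᵥ g))⁻¹ : P3) • (p ⨯₃ fun c => C (g c))

theorem degVle_tangentialPotential {g : V3} {p : VP3} {r : ℕ} (hp : degVle p r) :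
    degVle (tangentialPotential g p) r := by
  have hmul : ∀ c d, (p c * C (g d)).totalDegree ≤ r := fun c d =>
    (totalDegree_mul _ _).trans (by simpa using hp c)
  intro c
  refine (totalDegree_mul _ _).trans ?_
  rw [totalDegree_C, zero_add, ← pcross_eq_crossProduct]
  refine (totalDegree_sub _ _).trans (max_le (hmul _ _) ?_)
  exact hmul _ _

theorem evalV_tangentialPotential (g : V3) (p : VP3) (y : V3) :
    evalV (tangentialPotential g p) y = (4 * (g ⬝ᵥ g))⁻¹ • (evalV p y ⨯₃ g) := by
  ext1 c
  fin_cases c <;> simp [evalV, tangentialPotential, cross_apply]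

/-- Splitting of a polynomial vector field into its parts tangential and normal to `g`. -/
theorem eq_tangential_add_normal {g : V3} (hg : g ≠ 0) {p : VP3} {l q : P3}
    (hq : p ⬝ᵥ (fun c => C (g c)) = l * q) :
    p = (4 : ℝ) • pcross (fun c => C (g c)) (tangentialPotential g p) +
      (4 : ℝ) • fun c => l * (C ((4 * (g ⬝ᵥ g))⁻¹ * g c) * q) := by
  have hgg : g ⬝ᵥ g ≠ 0 := dotProduct_self_eq_zero.not.mpr hg
  have hK : (4 : P3) * C (4 * (g ⬝ᵥ g))⁻¹ * C (g ⬝ᵥ g) = 1 := by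
    rw [← map_ofNat C 4, ← C_mul, ← C_mul, ← C_1]
    congr 1
    field_simp
  have hself : (fun c => C (g c) : VP3) ⬝ᵥ (fun c => C (g c)) = C (g ⬝ᵥ g) := by
    simp [dotProduct]
  rw [pcross_eq_crossProduct, tangentialPotential, map_smul, cross_cross_eq_smul_sub_smul',
    hself, hq]
  ext1 c
  simp only [Pi.add_apply, Pi.smul_apply, Pi.sub_apply, smul_eq_mul, MvPolynomial.smul_eq_C_mul,
    C_mul]
  rw [map_ofNat C 4]
  linear_combination -p c * hK

end Alfeld

/-- representation `p_i = 4 ∇λ_i × v_i + 4 λ_i w_i` for piecewise polynomial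
vector fields with single-valued normal traces on interior faces and vanishing normal trace
on the boundary; moreover the tangential component of `v` is single-valued on each edge. -/
theorem statement7 (r : ℕ) (x : Fin 4 → V3) (hx : AffineIndependent ℝ x)
    (lam : Fin 4 → P3) (hlamdeg : ∀ i, (lam i).totalDegree ≤ 1)
    (hlam : ∀ i j, eval (x j) (lam i) = if i = j then 1 else 0)
    (p : Fin 4 → VP3) (hdeg : ∀ i, degVle (p i) r)
    (hnormInt : ∀ i j, i ≠ j → ∀ n, IsUnitNormalInt x i j n →
      ∀ y ∈ intFace x i j, (evalV (p i) y - evalV (p j) y) ⬝ᵥ n = 0)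
    (hnormBdry : ∀ i, ∀ n, IsUnitNormalBdry x i n →
      ∀ y ∈ bdryFace x i, evalV (p i) y ⬝ᵥ n = 0) :
    ∃ v w : Fin 4 → VP3,
      (∀ i, degVle (v i) r) ∧ (∀ i, degVle (w i) (r - 1)) ∧ (r = 0 → ∀ i, w i = 0) ∧
      (∀ i, p i = (4 : ℝ) • pcross (pgrad (lam i)) (v i) + (4 : ℝ) • fun c => lam i * w i c) ∧
      (∀ k l, k ≠ l → ∀ i j, i ≠ j → i ≠ k → i ≠ l → j ≠ k → j ≠ l →
        ∀ y ∈ segment ℝ (x k) (x l),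
          (evalV (v i) y - evalV (v j) y) ⬝ᵥ (x l - x k) = 0) := by
  choose g b hgb using fun i => exists_eq_affine (lam i) (hlamdeg i)
  have hev : ∀ i y, eval y (lam i) = b i + g i ⬝ᵥ y := fun i y => by
    rw [hgb i, eval_affine]
  have hgx : ∀ i j, g i ⬝ᵥ x j = (if i = j then 1 else 0) - b i := fun i j => by
    rw [← hlam i j, hev]
    ring
  have hg : ∀ i, g i ≠ 0 := by
    intro i hi
    have h1 := hgx i i
    have h2 := hgx i (i + 1)
    have hne : i ≠ i + 1 := by fin_cases i <;> decide
    rw [hi, zero_dotProduct, if_pos rfl] at h1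
    rw [hi, zero_dotProduct, if_neg hne] at h2
    linarith
  have hbdry : ∀ i, ∀ y ∈ bdryFace x i, evalV (p i) y ⬝ᵥ g i = 0 := by
    refine fun i y hy => dotProduct_eq_zero_of_unit (hg i) (hnormBdry i _
      ⟨inv_sqrt_smul_dotProduct_self (hg i), fun j k hj hk => ?_⟩ y hy)
    rw [smul_dotProduct, dotProduct_sub, hgx, hgx, if_neg hj.symm, if_neg hk.symm, sub_self,
      smul_zero]
  have hint : ∀ i j, i ≠ j → ∀ y ∈ intFace x i j,
      (evalV (p i) y - evalV (p j) y) ⬝ᵥ (g i - g j) = 0 := by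
    intro i j hij y hy
    have hne : g i - g j ≠ 0 := by
      intro h0
      have h1 := congrArg (· ⬝ᵥ (x i - x j)) h0
      simp only [sub_dotProduct, dotProduct_sub, hgx, zero_dotProduct, if_true, if_neg hij,
        if_neg hij.symm] at h1
      linarith
    refine dotProduct_eq_zero_of_unit hne (hnormInt i j hij _
      ⟨inv_sqrt_smul_dotProduct_self hne, fun k hki hkj => ?_⟩ y hy)
    have hsum : ∀ i, g i ⬝ᵥ bary x = 1 / 4 - b i := by
      intro i
      rw [bary, dotProduct_smul, dotProduct_add, dotProduct_add, dotProduct_add]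
      simp only [hgx, smul_eq_mul]
      fin_cases i <;> simp <;> ring
    have hk : (g i - g j) ⬝ᵥ (x k - bary x) = 0 := by
      rw [sub_dotProduct, dotProduct_sub, dotProduct_sub, hsum, hsum, hgx, hgx,
        if_neg hki.symm, if_neg hkj.symm]
      ring
    rw [smul_dotProduct, hk, smul_zero]
  have hdvd : ∀ i, lam i ∣ p i ⬝ᵥ fun c => C (g i c) := by
    intro i
    rw [hgb i]
    refine affine_dvd_of_forall_eval_eq_zero (hg i) fun y hy => ?_
    obtain ⟨a, ha, rfl⟩ := exists_weights hx y
    have hai : a i = 0 := by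
      rw [dotProduct_sum] at hy
      simp only [dotProduct_smul, hgx, smul_eq_mul, mul_sub, Finset.sum_sub_distrib,
        ← Finset.sum_mul, ha] at hy
      simpa using hy
    rw [← Finset.sum_erase Finset.univ (a := i) (by rw [hai, zero_smul])]
    refine eval_sum_smul_eq_zero (fun z hz => ?_) ((Finset.sum_erase _ hai).trans ha)
    have hz' : z ∈ bdryFace x i := by
      rwa [Finset.coe_erase, Finset.coe_univ, ← Set.compl_eq_univ_sdiff] at hz
    simpa [dotProduct, evalV] using hbdry i z hz'
  choose q hq using hdvd
  have hq0 : ∀ i, q i ≠ 0 → (q i).totalDegree + 1 ≤ r := by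
    intro i hqi
    have hl0 : lam i ≠ 0 := by
      intro h0
      have := hlam i i
      simp [h0] at this
    have hl1 : (lam i).totalDegree ≠ 0 := by
      intro h0
      rw [totalDegree_eq_zero_iff_eq_C] at h0
      have h1 := hlam i i
      have h2 := hlam i (i + 1)
      have hne : i ≠ i + 1 := by fin_cases i <;> decide
      rw [h0, eval_C] at h1 h2
      rw [if_pos rfl] at h1
      rw [if_neg hne, h1] at h2
      exact one_ne_zero h2
    have hle : (p i ⬝ᵥ fun c => C (g i c)).totalDegree ≤ r :=
      totalDegree_finsetSum_le fun c _ =>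
        (totalDegree_mul _ _).trans (by simpa using hdeg i c)
    rw [hq, totalDegree_mul_of_isDomain hl0 hqi] at hle
    omega
  refine ⟨fun i => tangentialPotential (g i) (p i),
    fun i c => C ((4 * (g i ⬝ᵥ g i))⁻¹ * g i c) * q i,
    fun i => degVle_tangentialPotential (hdeg i), fun i c => ?_, ?_, fun i => ?_, ?_⟩
  · by_cases hqi : q i = 0
    · simp [hqi]
    · have := hq0 i hqi
      refine (totalDegree_mul _ _).trans ?_
      rw [totalDegree_C]
      omega
  · rintro rfl i
    have hqi : q i = 0 := by
      by_contra h
      have := hq0 i h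
      omega
    ext1 c
    simp [hqi]
  · have hgrad : pgrad (lam i) = fun c => C (g i c) := by rw [hgb i, pgrad_affine]
    rw [hgrad]
    exact eq_tangential_add_normal (hg i) (hq i)
  · intro k l hkl i j hij hik hil hjk hjl y hy
    rw [← convexHull_pair] at hy
    have hy' : ∀ m, m ≠ k → m ≠ l → y ∈ bdryFace x m := by
      refine fun m hmk hml => convexHull_mono ?_ hy
      rintro _ (rfl | rfl)
      exacts [⟨k, hmk.symm, rfl⟩, ⟨l, hml.symm, rfl⟩]
    have hyint : y ∈ intFace x i j := by
      refine convexHull_mono ?_ hy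
      rintro _ (rfl | rfl)
      exacts [.inr ⟨k, ⟨hik.symm, hjk.symm⟩, rfl⟩, .inr ⟨l, ⟨hil.symm, hjl.symm⟩, rfl⟩]
    have hgt : ∀ m, m ≠ k → m ≠ l → g m ⬝ᵥ (x l - x k) = 0 := by
      intro m hmk hml
      rw [dotProduct_sub, hgx, hgx, if_neg hmk, if_neg hml, sub_self]
    have hN : g i ⨯₃ g j ≠ 0 := by
      intro h0
      have h1 := cross_dot_cross (g i) (g j) (x i - x k) (x j - x k)
      rw [h0, zero_dotProduct] at h1
      simp [dotProduct_sub, hgx, hij, hij.symm, hik, hjk] at h1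
    have key := cross_dotProduct_eq hN (hbdry i y (hy' i hik hil)) (hbdry j y (hy' j hjk hjl))
      (hint i j hij y hyint) (hgt i hik hil) (hgt j hjk hjl)
    rw [evalV_tangentialPotential, evalV_tangentialPotential, sub_dotProduct, smul_dotProduct,
      smul_dotProduct, smul_eq_mul, smul_eq_mul, mul_inv, mul_inv]
    linear_combination 4⁻¹ * key
end
end

section
/- Let r ≥ 1 and ℓ ≥ 0 be integers, and let (p₀,p₁,p₂,p₃) be a piecewise polynomial vector field of degree ≤ r on the Alfeld split T^z of a tetrahedron T ⊂ ℝ³ whose normal component is single-valued across interior faces ((p_i − p_j) · n_{ij} = 0 on F_{ij} for all i ≠ j) and whose normal trace vanishes on the boundary (p_i · n_i = 0 on F_i for each i). Then there exist a single polynomial map γ : ℝ³ → ℝ³ of degree ≤ r and a piecewise polynomial vector field (ψ₀,ψ₁,ψ₂,ψ₃) of degree ≤ r−1 whose normal component is single-valued across interior faces ((ψ_i − ψ_j) · n_{ij} = 0 on F_{ij} for all i ≠ j), such that for each i: (4λ_i)^ℓ p_i = curl((4λ_i)^{ℓ+1} γ) + (4λ_i)^{ℓ+1} ψ_i, where λ_i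 is the barycentric coordinate of T associated with x_i. -/
open MvPolynomial Matrix

noncomputable section

open Alfeld

namespace Alfeld

section Polynomial

variable {σ : Type*} [Fintype σ]

/-- If a polynomial is killed by every evaluation with positive coordinates outside `s` and zero
coordinates on `s`, then all coefficients of monomials not involving `s` vanish. -/
theorem coeff_eq_zero_of_eval_pos (s : Set σ) (f : MvPolynomial σ ℝ)
    (h : ∀ v : σ → ℝ, (∀ m ∈ s, v m = 0) → (∀ m ∉ s, 0 < v m) → eval v f = 0)
    (α : σ →₀ ℕ) (hα : ∀ m ∈ s, α m = 0) : coeff α f = 0 := by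
  classical
  set κ : MvPolynomial σ ℝ →ₐ[ℝ] MvPolynomial σ ℝ :=
    aeval (fun m => if m ∈ s then 0 else X m) with hκ
  have hzero : κ f = 0 := by
    refine funext_set (fun _ => Set.Ioi 0) (fun _ => Set.Ioi_infinite 0) fun v hv => ?_
    have := h (fun m => if m ∈ s then 0 else v m) (by simp +contextual)
      (fun m hm => by simpa [hm] using hv m trivial)
    rw [map_zero, ← this, hκ, aeval_def, eval_eval₂, eval, coe_eval₂Hom]
    congr 1
    · ext; simp
    · ext m; split_ifs <;> simp
  have hcoeff : ∀ g : MvPolynomial σ ℝ, coeff α (κ g) = coeff α g := by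
    intro g
    induction g using MvPolynomial.induction_on' with
    | add p q hp hq => simp [hp, hq]
    | monomial β c =>
      by_cases hβ : ∀ m ∈ s, β m = 0
      · have : κ (monomial β c) = monomial β c := by
          rw [hκ, aeval_monomial, monomial_eq]
          congr 1
          refine Finsupp.prod_congr fun m hm => ?_
          rw [if_neg fun hms => Finsupp.mem_support_iff.1 hm (hβ m hms)]
        rw [this]
      · push Not at hβ
        obtain ⟨m, hm, hβm⟩ := hβ
        have : κ (monomial β c) = 0 := by
          rw [hκ, aeval_monomial, Finsupp.prod,
            Finset.prod_eq_zero (Finsupp.mem_support_iff.2 hβm) (by simp [hm, hβm]), mul_zero]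
        rw [this, coeff_zero, coeff_monomial, if_neg]
        rintro rfl
        exact hβm (hα m hm)
  rw [← hcoeff, hzero, coeff_zero]

/-- A homogeneous polynomial vanishing on the open face `{v = 0 on s}` of the standard simplex has
no monomials supported away from `s`. -/
theorem coeff_eq_zero_of_eval_simplex {r : ℕ} (s : Set σ) (hs : s ≠ Set.univ)
    {f : MvPolynomial σ ℝ} (hf : f.IsHomogeneous r)
    (h : ∀ v : σ → ℝ, (∀ m ∈ s, v m = 0) → (∀ m, 0 ≤ v m) → ∑ m, v m = 1 → eval v f = 0)
    (α : σ →₀ ℕ) (hα : ∀ m ∈ s, α m = 0) : coeff α f = 0 := by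
  refine coeff_eq_zero_of_eval_pos s f (fun v hv hpos => ?_) α hα
  have hnn : ∀ m, 0 ≤ v m := fun m => by
    by_cases hm : m ∈ s
    · exact (hv m hm).ge
    · exact (hpos m hm).le
  obtain ⟨m₀, hm₀⟩ := (Set.ne_univ_iff_exists_notMem s).1 hs
  have hsum : 0 < ∑ m, v m :=
    Finset.sum_pos' (fun m _ => hnn m) ⟨m₀, Finset.mem_univ _, hpos m₀ hm₀⟩
  set S := ∑ m, v m
  have hscale : eval v f = S ^ r * eval (fun m => v m / S) f := by
    rw [eval_eq, eval_eq, Finset.mul_sum]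
    refine Finset.sum_congr rfl fun β hβ => ?_
    have hdeg : ∑ m, β m = r := by
      rw [← Finsupp.degree_eq_sum]
      exact not_imp_comm.1 hf.coeff_eq_zero (mem_support_iff.1 hβ)
    simp_rw [Finset.prod_subset (Finset.subset_univ β.support)
      (fun m _ hm => by simp [Finsupp.notMem_support_iff.1 hm] :
        ∀ m ∈ Finset.univ, m ∉ β.support → v m ^ β m = 1),
      Finset.prod_subset (Finset.subset_univ β.support)
      (fun m _ hm => by simp [Finsupp.notMem_support_iff.1 hm] :
        ∀ m ∈ Finset.univ, m ∉ β.support → (v m / S) ^ β m = 1)]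
    simp_rw [div_pow, Finset.prod_div_distrib, Finset.prod_pow_eq_pow_sum, hdeg]
    field_simp
  rw [hscale, h, mul_zero]
  · intro m hm; simp [hv m hm]
  · intro m; exact div_nonneg (hnn m) hsum.le
  · rw [← Finset.sum_div, div_self hsum.ne']

omit [Fintype σ] in
theorem X_dvd_of_coeff {i : σ} {f : MvPolynomial σ ℝ}
    (h : ∀ α : σ →₀ ℕ, α i = 0 → coeff α f = 0) : X i ∣ f := by
  rw [f.as_sum]
  exact Finset.dvd_sum fun α hα =>
    X_dvd_monomial.2 (.inr fun hi => mem_support_iff.1 hα (h α hi))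

omit [Fintype σ] in
theorem totalDegree_aeval_le {τ : Type*} {r : ℕ} {f : MvPolynomial σ ℝ} (hf : f.totalDegree ≤ r)
    {g : σ → MvPolynomial τ ℝ} (hg : ∀ i, (g i).totalDegree ≤ 1) :
    (aeval g f).totalDegree ≤ r := by
  rw [f.as_sum, map_sum]
  refine totalDegree_finsetSum_le fun α hα => ?_
  rw [aeval_monomial, algebraMap_eq]
  refine (totalDegree_mul _ _).trans ?_
  rw [totalDegree_C, zero_add]
  refine ((totalDegree_finsetProd _ _).trans (Finset.sum_le_sum fun i _ => ?_)).trans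
    ((le_totalDegree hα).trans hf)
  exact (totalDegree_pow _ _).trans (mul_le_of_le_one_right (Nat.zero_le _) (hg i))

omit [Fintype σ] in
theorem totalDegree_pderiv_le_sub_one (i : σ) (f : MvPolynomial σ ℝ) :
    (pderiv i f).totalDegree ≤ f.totalDegree - 1 := by
  classical
  conv_lhs => rw [f.as_sum, map_sum]
  refine totalDegree_finsetSum_le fun α hα => ?_
  rw [pderiv_monomial]
  by_cases hi : α i = 0
  · simp [hi]
  refine (totalDegree_monomial_le _ _).trans ?_
  have h1 := le_totalDegree hα
  have h2 : (α - Finsupp.single i 1) + Finsupp.single i 1 = α :=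
    tsub_add_cancel_of_le (Finsupp.single_le_iff.2 (Nat.one_le_iff_ne_zero.2 hi))
  have h3 := congrArg Finsupp.degree h2
  rw [map_add, Finsupp.degree_single] at h3
  change (α - Finsupp.single i 1).degree ≤ _
  change α.degree ≤ _ at h1
  omega

theorem eq_affine_of_totalDegree_le_one {f : MvPolynomial σ ℝ} (hf : f.totalDegree ≤ 1) :
    f = C (coeff 0 f) + ∑ c, C (coeff (Finsupp.single c 1) f) * X c := by
  classical
  ext α
  simp only [coeff_add, coeff_C, coeff_sum, coeff_C_mul, coeff_X]
  rcases Nat.lt_or_ge 1 α.degree with h | h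
  · have : coeff α f = 0 := coeff_eq_zero_of_totalDegree_lt (hf.trans_lt h)
    rw [this, if_neg (by rintro rfl; simp at h), Finset.sum_eq_zero, zero_add]
    intro c _
    rw [if_neg (by rintro rfl; simp at h), mul_zero]
  · by_cases h0 : α = 0
    · subst h0; simp
    · have h1 : α.degree = 1 := by
        have := mt (Finsupp.degree_eq_zero_iff α).1 h0
        omega
      obtain ⟨c, rfl⟩ : ∃ c, α = Finsupp.single c 1 := by
        obtain ⟨c, hc⟩ := Finsupp.ne_iff.1 h0
        refine ⟨c, ?_⟩
        have hle : Finsupp.single c 1 ≤ α :=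
          Finsupp.single_le_iff.2 (Nat.one_le_iff_ne_zero.2 hc)
        have h3 := congrArg Finsupp.degree (tsub_add_cancel_of_le hle)
        rw [map_add, Finsupp.degree_single, h1] at h3
        have h4 : α - Finsupp.single c 1 = 0 := (Finsupp.degree_eq_zero_iff _).1 (by omega)
        rw [← tsub_add_cancel_of_le hle, h4, zero_add]
      simp [Finsupp.single_left_inj, eq_comm]

end Polynomial

/-- Patching values on the faces of a simplex: the vertices outside the support of a monomial
index the faces on which this monomial is visible. -/
theorem exists_patch {s : Set (Fin 4)} {k : Fin 4} (hk : k ∉ s) (M : Fin 4 → Fin 4 → ℝ)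
    (hM : ∀ i ∈ s, ∀ j ∈ s, ∀ a b, a ≠ i → a ≠ j → b ≠ i → b ≠ j →
      M i a - M i b = M j a - M j b) :
    ∃ c : Fin 4 → ℝ, ∀ i ∈ s, ∀ a b, a ≠ i → b ≠ i → c a - c b = M i a - M i b := by
  classical
  let c : Fin 4 → ℝ := fun a =>
    if h : ∃ i, i ∈ s ∧ a ≠ i then M h.choose a - M h.choose k else 0
  have hc : ∀ i ∈ s, ∀ a, a ≠ i → c a = M i a - M i k := by
    intro i hi a ha
    have h : ∃ i, i ∈ s ∧ a ≠ i := ⟨i, hi, ha⟩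
    simp only [c, dif_pos h]
    exact hM _ h.choose_spec.1 i hi a k h.choose_spec.2 ha
      (fun e => hk (e ▸ h.choose_spec.1)) (fun e => hk (e ▸ hi))
  refine ⟨c, fun i hi a b ha hb => ?_⟩
  rw [hc i hi a ha, hc i hi b hb]
  ring

/-- Compatible families of homogeneous polynomials on the faces of a simplex extend to its
interior. -/
theorem exists_extension {r : ℕ} (hr : 1 ≤ r) (U : Fin 4 → Fin 4 → MvPolynomial (Fin 4) ℝ)
    (hU : ∀ i a, (U i a).IsHomogeneous r)
    (hcompat : ∀ i j a b, i ≠ j → a ≠ i → a ≠ j → b ≠ i → b ≠ j → ∀ α : Fin 4 →₀ ℕ,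
      α i = 0 → α j = 0 → coeff α (U i a - U i b - (U j a - U j b)) = 0) :
    ∃ u : Fin 4 → MvPolynomial (Fin 4) ℝ, (∀ a, (u a).IsHomogeneous r) ∧
      ∀ i a b, a ≠ i → b ≠ i → ∀ v : Fin 4 → ℝ, v i = 0 →
        eval v (u a) - eval v (u b) = eval v (U i a) - eval v (U i b) := by
  classical
  have key : ∀ α : Fin 4 →₀ ℕ, ∃ c : Fin 4 → ℝ, α.degree = r → ∀ i, α i = 0 → ∀ a b,
      a ≠ i → b ≠ i → c a - c b = coeff α (U i a) - coeff α (U i b) := by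
    intro α
    by_cases hα : α.degree = r
    · obtain ⟨k, hk⟩ : ∃ k, α k ≠ 0 := by
        by_contra! h
        have : α = 0 := by ext k; simp [h k]
        subst this
        simp at hα
        omega
      obtain ⟨c, hc⟩ := exists_patch (s := {i | α i = 0}) (k := k) hk
        (fun i a => coeff α (U i a)) (fun i hi j hj a b hai haj hbi hbj => by
          by_cases hij : i = j
          · subst hij; rfl
          · have := hcompat i j a b hij hai haj hbi hbj α hi hj
            simp only [coeff_sub] at this
            linarith)
      exact ⟨c, fun _ => hc⟩
    · exact ⟨0, fun h => absurd h hα⟩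
  choose c hc using key
  set S : Finset (Fin 4 →₀ ℕ) := Finset.univ.biUnion fun i => Finset.univ.biUnion fun a =>
    (U i a).support with hS
  have hsupp : ∀ i a, (U i a).support ⊆ S := fun i a α hα => by
    simp only [hS, Finset.mem_biUnion]
    exact ⟨i, Finset.mem_univ _, a, Finset.mem_univ _, hα⟩
  have hSdeg : ∀ α ∈ S, α.degree = r := by
    intro α hα
    simp only [hS, Finset.mem_biUnion] at hα
    obtain ⟨i, -, a, -, h⟩ := hα
    exact not_imp_comm.1 (hU i a).coeff_eq_zero (mem_support_iff.1 h)
  refine ⟨fun a => ∑ α ∈ S, monomial α (c α a), fun a => IsHomogeneous.sum _ _ _ fun α hα =>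
    isHomogeneous_monomial _ (hSdeg α hα), fun i a b ha hb v hv => ?_⟩
  have hexp : ∀ i a, eval v (U i a) = ∑ α ∈ S, coeff α (U i a) * ∏ m, v m ^ α m := by
    intro i a
    rw [eval_eq']
    exact Finset.sum_subset (hsupp i a) fun α _ h => by rw [notMem_support_iff.1 h, zero_mul]
  simp only [hexp, map_sum, eval_monomial, ← Finset.sum_sub_distrib, ← sub_mul]
  refine Finset.sum_congr rfl fun α hα => ?_
  rw [Finsupp.prod_fintype _ _ (by simp)]
  by_cases hi : α i = 0
  · rw [hc α (hSdeg α hα) i hi a b ha hb]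
  · rw [Finset.prod_eq_zero (Finset.mem_univ i) (by rw [hv, zero_pow hi]), mul_zero, mul_zero]

theorem exists_ne_ne : ∀ i j : Fin 4, ∃ k, k ≠ i ∧ k ≠ j := by decide

/-- `N i` is the gradient of the `i`-th barycentric coordinate of the simplex with vertices `x`,
and `c i` is its value at the origin. -/
structure IsDual (x N : Fin 4 → V3) (c : Fin 4 → ℝ) : Prop where
  pairing : ∀ i j, c i + N i ⬝ᵥ x j = if i = j then 1 else 0
  sum_const : ∑ i, c i = 1
  sum_const_smul : ∀ d, ∑ i, c i * x i d = 0
  sum_grad : ∀ d, ∑ i, N i d = 0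
  sum_grad_smul : ∀ d e, ∑ i, N i d * x i e = if d = e then 1 else 0

theorem isDual_of_pairing {x N : Fin 4 → V3} {c : Fin 4 → ℝ}
    (h : ∀ i j, c i + N i ⬝ᵥ x j = if i = j then 1 else 0) : IsDual x N c := by
  let A : Matrix (Fin 4) (Option (Fin 3)) ℝ := Matrix.of fun i o => o.elim (c i) (N i)
  let B : Matrix (Option (Fin 3)) (Fin 4) ℝ := Matrix.of fun o j => o.elim 1 (x j)
  have hAB : A * B = 1 := by
    ext i j
    rw [Matrix.mul_apply, Fintype.sum_option, Matrix.one_apply, ← h i j]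
    simp [A, B, dotProduct]
  have hBA : B * A = 1 :=
    (Matrix.mul_eq_one_comm_of_equiv (by simpa using (finSuccEquiv 3))).1 hAB
  have hentry : ∀ o o', ∑ i, B o i * A i o' = if o = o' then 1 else 0 := fun o o' => by
    rw [← Matrix.mul_apply, hBA, Matrix.one_apply]
  refine ⟨h, ?_, fun d => ?_, fun d => ?_, fun d e => ?_⟩
  · simpa [A, B] using hentry none none
  · simpa [A, B, mul_comm] using hentry (some d) none
  · simpa [A, B] using hentry none (some d)
  · simpa [A, B, mul_comm, eq_comm] using hentry (some e) (some d)

theorem exists_isDual {x : Fin 4 → V3} {lam : Fin 4 → P3}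
    (hlamdeg : ∀ i, (lam i).totalDegree ≤ 1)
    (hlam : ∀ i j, eval (x j) (lam i) = if i = j then 1 else 0) :
    ∃ N c, IsDual x N c ∧ ∀ i, lam i = C (c i) + ∑ d, C (N i d) * X d := by
  have haff := fun i => eq_affine_of_totalDegree_le_one (hlamdeg i)
  refine ⟨fun i d => coeff (Finsupp.single d 1) (lam i), fun i => coeff 0 (lam i),
    isDual_of_pairing fun i j => ?_, haff⟩
  rw [← hlam i j]
  conv_rhs => rw [haff i]
  simp [dotProduct]

namespace IsDual

variable {x N : Fin 4 → V3} {c : Fin 4 → ℝ} (h : IsDual x N c)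
include h

theorem pairing_sub (i j k : Fin 4) :
    N i ⬝ᵥ (x j - x k) = (if i = j then 1 else 0) - if i = k then 1 else 0 := by
  rw [dotProduct_sub, ← h.pairing i j, ← h.pairing i k]
  ring

theorem expand (v : V3) : v = ∑ m, (v ⬝ᵥ x m) • N m := by
  ext d
  simp only [Finset.sum_apply, Pi.smul_apply, smul_eq_mul, dotProduct, Finset.sum_mul]
  rw [Finset.sum_comm]
  simp_rw [fun e m => show v e * x m e * N m d = v e * (N m d * x m e) by ring,
    ← Finset.mul_sum, h.sum_grad_smul]
  simp

theorem sum_grad_eq_zero : ∑ m, N m = 0 := by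
  ext d
  simpa using h.sum_grad d

theorem expand_sub (v y : V3) : v = ∑ m, (v ⬝ᵥ (x m - y)) • N m := by
  conv_lhs => rw [h.expand v]
  simp only [dotProduct_sub, sub_smul, Finset.sum_sub_distrib, ← Finset.smul_sum,
    h.sum_grad_eq_zero, smul_zero, sub_zero]

theorem exists_eq_smul {i : Fin 4} {v : V3}
    (hv : ∀ a b, a ≠ i → b ≠ i → v ⬝ᵥ (x a - x b) = 0) : ∃ t : ℝ, v = t • N i := by
  obtain ⟨b, hb⟩ := exists_ne i
  refine ⟨v ⬝ᵥ (x i - x b), ?_⟩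
  conv_lhs => rw [h.expand_sub v (x b)]
  exact Finset.sum_eq_single i (fun a _ ha => by rw [hv a b ha hb, zero_smul]) (by simp)

theorem exists_eq_smul_sub {i j : Fin 4} (hij : i ≠ j) {v : V3}
    (hv : ∀ k, k ≠ i → k ≠ j → v ⬝ᵥ (x k - bary x) = 0) : ∃ t : ℝ, v = t • (N i - N j) := by
  have hexp := h.expand_sub v (bary x)
  have hz : ∑ m, (x m - bary x) = 0 := by
    ext d
    simp [Fin.sum_univ_four, bary]
  have hsum : ∑ m, v ⬝ᵥ (x m - bary x) = 0 := by
    rw [← dotProduct_sum, hz, dotProduct_zero]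
  have hpair : ∀ {M : Type} [AddCommMonoid M] (f : Fin 4 → M),
      (∀ k, k ≠ i → k ≠ j → f k = 0) → ∑ m, f m = f i + f j := fun f hf =>
    Finset.sum_eq_add i j hij (fun k _ hk => hf k hk.1 hk.2) (by simp) (by simp)
  rw [hpair _ fun k hi hj => by rw [hv k hi hj, zero_smul]] at hexp
  rw [hpair _ hv] at hsum
  refine ⟨v ⬝ᵥ (x i - bary x), hexp.trans ?_⟩
  rw [eq_neg_of_add_eq_zero_right hsum, smul_sub, neg_smul, ← sub_eq_add_neg]

theorem grad_ne_zero (i : Fin 4) : N i ≠ 0 := by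
  obtain ⟨j, hj⟩ := exists_ne i
  intro h0
  have := h.pairing_sub i i j
  simp [h0, hj.symm] at this

theorem grad_sub_ne_zero {i j : Fin 4} (hij : i ≠ j) : N i - N j ≠ 0 := by
  intro h0
  have h1 := h.pairing_sub i i j
  have h2 := h.pairing_sub j i j
  have h3 : (N i - N j) ⬝ᵥ (x i - x j) = 0 := by rw [h0, zero_dotProduct]
  rw [sub_dotProduct, h1, h2] at h3
  norm_num [hij, hij.symm] at h3

theorem grad_sub_bary {i k : Fin 4} (hk : k ≠ i) : N i ⬝ᵥ (x k - bary x) = -(1 / 4) := by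
  have h4 : x k - bary x = (4 : ℝ)⁻¹ • ∑ m, (x k - x m) := by
    ext d
    simp [Fin.sum_univ_four, bary]
    ring
  rw [h4, dotProduct_smul, dotProduct_sum]
  simp_rw [h.pairing_sub, if_neg hk.symm]
  simp

theorem grad_sub_orthogonal {i j k : Fin 4} (hi : k ≠ i) (hj : k ≠ j) :
    (N i - N j) ⬝ᵥ (x k - bary x) = 0 := by
  rw [sub_dotProduct, h.grad_sub_bary hi, h.grad_sub_bary hj, sub_self]

theorem crossProduct_ne_zero {i j : Fin 4} (hij : i ≠ j) : crossProduct (N i) (N j) ≠ 0 := by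
  obtain ⟨k, hki, hkj⟩ := exists_ne_ne i j
  intro h0
  have := cross_dot_cross (N i) (N j) (x i - x k) (x j - x k)
  rw [h0, zero_dotProduct] at this
  simp only [h.pairing_sub] at this
  simp [hij, hij.symm, hki.symm, hkj.symm] at this

end IsDual

theorem exists_unit_smul {v : V3} (hv : v ≠ 0) : ∃ t : ℝ, t ≠ 0 ∧ (t • v) ⬝ᵥ (t • v) = 1 := by
  have hpos : 0 < v ⬝ᵥ v := by
    exact lt_of_le_of_ne (Finset.sum_nonneg fun i _ => mul_self_nonneg _)
      (Ne.symm (mt dotProduct_self_eq_zero.1 hv))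
  refine ⟨(√(v ⬝ᵥ v))⁻¹, by positivity, ?_⟩
  rw [smul_dotProduct, dotProduct_smul, smul_smul, smul_eq_mul, ← mul_inv,
    Real.mul_self_sqrt hpos.le, inv_mul_cancel₀ hpos.ne']

theorem sum_smul_mem_convexHull (x : Fin 4 → V3) {s : Set (Fin 4)} {v : Fin 4 → ℝ}
    (hv : ∀ m, 0 ≤ v m) (hsum : ∑ m, v m = 1) (hs : ∀ m ∉ s, v m = 0) :
    ∑ m, v m • x m ∈ convexHull ℝ (x '' s) := by
  classical
  have hsub : ∀ {M : Type} [AddCommMonoid M] (f : Fin 4 → M), (∀ m, v m = 0 → f m = 0) →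
      ∑ m ∈ Finset.univ.filter (· ∈ s), f m = ∑ m, f m := fun f hf =>
    Finset.sum_subset (Finset.filter_subset _ _) fun m _ hm => hf m (hs m (by simpa using hm))
  rw [← hsub _ fun m hm => by rw [hm, zero_smul]]
  refine (convex_convexHull ℝ _).sum_mem (fun m _ => hv m) ?_ fun m hm => ?_
  · rw [hsub _ fun _ => id, hsum]
  · exact subset_convexHull ℝ _ ⟨m, by simpa using hm, rfl⟩

/-- Compatibility along an edge with direction `t` of the tangential fields determined on the two
adjacent faces with normals `N` and `M`. -/
theorem tangential_edge_compat {N M t p q : V3} (hNM : crossProduct N M ≠ 0)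
    (htN : t ⬝ᵥ N = 0) (htM : t ⬝ᵥ M = 0) (hp : p ⬝ᵥ N = 0) (hq : q ⬝ᵥ M = 0)
    (hpq : p ⬝ᵥ M + q ⬝ᵥ N = 0) :
    (N ⬝ᵥ N)⁻¹ * (p ⬝ᵥ crossProduct N t) = (M ⬝ᵥ M)⁻¹ * (q ⬝ᵥ crossProduct M t) := by
  have hN : N ⬝ᵥ N ≠ 0 := by
    rw [Ne, dotProduct_self_eq_zero]; rintro rfl; simp at hNM
  have hM : M ⬝ᵥ M ≠ 0 := by
    rw [Ne, dotProduct_self_eq_zero]; rintro rfl; simp at hNM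
  set w := crossProduct N M with hw
  have hww : w ⬝ᵥ w ≠ 0 := by rwa [Ne, dotProduct_self_eq_zero]
  obtain ⟨τ, rfl⟩ : ∃ τ : ℝ, t = τ • w := by
    refine ⟨(t ⬝ᵥ w) / (w ⬝ᵥ w), ?_⟩
    have hkey : (w ⬝ᵥ w) • t = (t ⬝ᵥ w) • w := by
      simp only [hw, cross_apply, dotProduct, Fin.sum_univ_three] at htN htM ⊢
      ext d
      fin_cases d <;> simp
      · linear_combination ((N 2 * M 0 - N 0 * M 2) * N 2 - (N 0 * M 1 - N 1 * M 0) * N 1) * htM -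
          ((N 2 * M 0 - N 0 * M 2) * M 2 - (N 0 * M 1 - N 1 * M 0) * M 1) * htN
      · linear_combination ((N 0 * M 1 - N 1 * M 0) * N 0 - (N 1 * M 2 - N 2 * M 1) * N 2) * htM -
          ((N 0 * M 1 - N 1 * M 0) * M 0 - (N 1 * M 2 - N 2 * M 1) * M 2) * htN
      · linear_combination ((N 1 * M 2 - N 2 * M 1) * N 1 - (N 2 * M 0 - N 0 * M 2) * N 0) * htM -
          ((N 1 * M 2 - N 2 * M 1) * M 1 - (N 2 * M 0 - N 0 * M 2) * M 0) * htN
    rw [div_eq_inv_mul, mul_smul, ← hkey, smul_smul, inv_mul_cancel₀ hww, one_smul]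
  have h1 : p ⬝ᵥ crossProduct N (τ • w) = - τ * (N ⬝ᵥ N) * (p ⬝ᵥ M) := by
    simp only [hw, cross_apply, dotProduct, Fin.sum_univ_three, Pi.smul_apply] at hp ⊢
    simp
    linear_combination τ * (N 0 * M 0 + N 1 * M 1 + N 2 * M 2) * hp
  have h2 : q ⬝ᵥ crossProduct M (τ • w) = τ * (M ⬝ᵥ M) * (q ⬝ᵥ N) := by
    simp only [hw, cross_apply, dotProduct, Fin.sum_univ_three, Pi.smul_apply] at hq ⊢
    simp
    linear_combination - τ * (N 0 * M 0 + N 1 * M 1 + N 2 * M 2) * hq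
  rw [h1, h2]
  field_simp
  linear_combination - τ * hpq

/-- Every polynomial of degree at most `r` is a homogeneous polynomial of degree `r` in the
barycentric coordinates. -/
theorem exists_homogenization_s8 {r : ℕ} {x : Fin 4 → V3} {lam : Fin 4 → P3}
    (hsum : ∑ i, lam i = 1) (hX : ∀ d, ∑ i, C (x i d) * lam i = X d)
    {q : P3} (hq : q.totalDegree ≤ r) :
    ∃ Q : MvPolynomial (Fin 4) ℝ, Q.IsHomogeneous r ∧ aeval lam Q = q := by
  refine ⟨∑ α ∈ q.support, C (coeff α q) * ((∏ d, (∑ i, C (x i d) * X i) ^ α d) *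
    (∑ i, X i) ^ (r - α.degree)), IsHomogeneous.sum _ _ _ fun α hα => ?_, ?_⟩
  · have hα' : α.degree ≤ r := (le_totalDegree hα).trans hq
    refine IsHomogeneous.C_mul ?_ _
    have h1 : (∏ d, (∑ i, C (x i d) * X i : MvPolynomial (Fin 4) ℝ) ^ α d).IsHomogeneous
        α.degree := by
      rw [Finsupp.degree_eq_sum]
      refine IsHomogeneous.prod _ _ _ fun d _ => ?_
      simpa using (IsHomogeneous.sum Finset.univ _ 1 fun i _ =>
        isHomogeneous_C_mul_X (x i d) i).pow (α d)
    have h2 : ((∑ i, X i : MvPolynomial (Fin 4) ℝ) ^ (r - α.degree)).IsHomogeneous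
        (r - α.degree) := by
      simpa using (IsHomogeneous.sum Finset.univ _ 1 fun i _ =>
        isHomogeneous_X ℝ i).pow (r - α.degree)
    simpa [Nat.add_sub_cancel' hα'] using h1.mul h2
  · conv_rhs => rw [q.as_sum]
    rw [map_sum]
    refine Finset.sum_congr rfl fun α _ => ?_
    simp only [map_mul, map_prod, map_pow, map_sum, aeval_X, aeval_C, algebraMap_eq, hsum, hX,
      one_pow, mul_one]
    rw [monomial_eq, Finsupp.prod_fintype _ _ (by simp)]

theorem eval_eq_zero_of_eval_simplex {r : ℕ} {i j : Fin 4} {f : MvPolynomial (Fin 4) ℝ}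
    (hf : f.IsHomogeneous r)
    (h : ∀ v : Fin 4 → ℝ, v i = 0 → v j = 0 → (∀ m, 0 ≤ v m) → ∑ m, v m = 1 → eval v f = 0)
    {v : Fin 4 → ℝ} (hi : v i = 0) (hj : v j = 0) : eval v f = 0 := by
  rw [eval_eq']
  refine Finset.sum_eq_zero fun α _ => ?_
  by_cases hα : α i = 0 ∧ α j = 0
  · rw [coeff_eq_zero_of_eval_simplex {i, j} ?_ hf ?_ α ?_, zero_mul]
    · obtain ⟨k, hki, hkj⟩ := exists_ne_ne i j
      exact (Set.ne_univ_iff_exists_notMem _).2 ⟨k, by simp [hki, hkj]⟩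
    · exact fun v hv => h v (hv i (by simp)) (hv j (by simp))
    · rintro m (rfl | rfl)
      exacts [hα.1, hα.2]
  · rcases not_and_or.1 hα with hα | hα
    · rw [Finset.prod_eq_zero (Finset.mem_univ i) (by rw [hi, zero_pow hα]), mul_zero]
    · rw [Finset.prod_eq_zero (Finset.mem_univ j) (by rw [hj, zero_pow hα]), mul_zero]

theorem cross3_eq_crossProduct (u v : V3) : cross3 u v = crossProduct u v := by
  ext d
  fin_cases d <;> simp [cross3, cross_apply]

/-- Homogeneous form of the extension of tangential traces: a single field `G` with prescribed
`K • N i × G` on each face of the simplex. -/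
theorem exists_tangential_extension {r : ℕ} (hr : 1 ≤ r) {x N : Fin 4 → V3} {c : Fin 4 → ℝ}
    (h : IsDual x N c) {K : ℝ} (hK : K ≠ 0) (P : Fin 4 → Fin 3 → MvPolynomial (Fin 4) ℝ)
    (hP : ∀ i d, (P i d).IsHomogeneous r)
    (hN : ∀ i (v : Fin 4 → ℝ), v i = 0 → (fun d => eval v (P i d)) ⬝ᵥ N i = 0)
    (hE : ∀ i j, i ≠ j → ∀ v : Fin 4 → ℝ, v i = 0 → v j = 0 →
      (fun d => eval v (P i d)) ⬝ᵥ N j + (fun d => eval v (P j d)) ⬝ᵥ N i = 0) :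
    ∃ G : Fin 3 → MvPolynomial (Fin 4) ℝ, (∀ d, (G d).IsHomogeneous r) ∧
      ∀ i (v : Fin 4 → ℝ), v i = 0 →
        K • cross3 (N i) (fun d => eval v (G d)) = fun d => eval v (P i d) := by
  let U : Fin 4 → Fin 4 → MvPolynomial (Fin 4) ℝ := fun i a =>
    ∑ d, C (K⁻¹ * (N i ⬝ᵥ N i)⁻¹ * crossProduct (N i) (x a) d) * P i d
  have hUeval : ∀ i a v, eval v (U i a) =
      K⁻¹ * (N i ⬝ᵥ N i)⁻¹ * ((fun d => eval v (P i d)) ⬝ᵥ crossProduct (N i) (x a)) := by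
    intro i a v
    simp only [U, map_sum, map_mul, eval_C, dotProduct, Finset.mul_sum]
    exact Finset.sum_congr rfl fun d _ => by ring
  have hUsub : ∀ i a b v, eval v (U i a) - eval v (U i b) = K⁻¹ * ((N i ⬝ᵥ N i)⁻¹ *
      ((fun d => eval v (P i d)) ⬝ᵥ crossProduct (N i) (x a - x b))) := by
    intro i a b v
    rw [hUeval, hUeval, map_sub, dotProduct_sub]
    ring
  have horth : ∀ i a b, a ≠ i → b ≠ i → (x a - x b) ⬝ᵥ N i = 0 := fun i a b ha hb => by
    rw [dotProduct_comm, h.pairing_sub, if_neg ha.symm, if_neg hb.symm, sub_zero]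
  obtain ⟨u, hu, huU⟩ := exists_extension hr U
    (fun i a => IsHomogeneous.sum _ _ _ fun d _ => (hP i d).C_mul _) <| by
      intro i j a b hij hai haj hbi hbj α hαi hαj
      refine coeff_eq_zero_of_eval_pos {i, j} _ (fun v hv _ => ?_) α ?_
      · have hvi := hv i (by simp)
        have hvj := hv j (by simp)
        rw [map_sub, map_sub, map_sub, hUsub, hUsub, sub_eq_zero,
          tangential_edge_compat (h.crossProduct_ne_zero hij) (horth i a b hai hbi)
            (horth j a b haj hbj) (hN i v hvi) (hN j v hvj) (hE i j hij v hvi hvj)]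
      · rintro m (rfl | rfl)
        exacts [hαi, hαj]
  refine ⟨fun d => ∑ m, C (N m d) * u m,
    fun d => IsHomogeneous.sum _ _ _ fun m _ => (hu m).C_mul _, fun i v hv => ?_⟩
  set Pv : V3 := fun d => eval v (P i d) with hPv
  have hG : (fun d => eval v (∑ m, C (N m d) * u m)) = ∑ m, eval v (u m) • N m := by
    ext d
    simp [mul_comm]
  have hGx : ∀ a b, (∑ m, eval v (u m) • N m) ⬝ᵥ (x a - x b) = eval v (u a) - eval v (u b) := by
    intro a b
    simp only [sum_dotProduct, smul_dotProduct, h.pairing_sub, smul_eq_mul, mul_sub,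
      Finset.sum_sub_distrib]
    simp
  set g : V3 := (K⁻¹ * (N i ⬝ᵥ N i)⁻¹) • crossProduct Pv (N i) with hg
  obtain ⟨t, ht⟩ : ∃ t : ℝ, ∑ m, eval v (u m) • N m - g = t • N i := by
    refine h.exists_eq_smul fun a b ha hb => ?_
    have htriple : Pv ⬝ᵥ crossProduct (N i) (x a - x b) = crossProduct Pv (N i) ⬝ᵥ (x a - x b) := by
      rw [triple_product_permutation, triple_product_permutation, dotProduct_comm]
    rw [sub_dotProduct, hGx, huU i a b ha hb v hv, hUsub, ← hPv, htriple, hg, smul_dotProduct,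
      smul_eq_mul, ← mul_assoc, sub_self]
  have hNN : N i ⬝ᵥ N i ≠ 0 := mt dotProduct_self_eq_zero.1 (h.grad_ne_zero i)
  rw [hG, sub_eq_iff_eq_add.1 ht, cross3_eq_crossProduct, map_add, map_smul, cross_self, smul_zero,
    zero_add, hg, map_smul, smul_smul]
  have hcross : crossProduct (N i) (crossProduct Pv (N i)) = (N i ⬝ᵥ N i) • Pv := by
    have h0 := hN i v hv
    rw [← hPv] at h0
    simp only [dotProduct, Fin.sum_univ_three, cross_apply] at h0 ⊢
    ext d
    fin_cases d <;> simp
    · linear_combination - N i 0 * h0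
    · linear_combination - N i 1 * h0
    · linear_combination - N i 2 * h0
  rw [hcross, smul_smul, ← mul_assoc, mul_inv_cancel₀ hK, one_mul, inv_mul_cancel₀ hNN, one_smul]

namespace IsDual

variable {x N : Fin 4 → V3} {c : Fin 4 → ℝ} (h : IsDual x N c) {lam : Fin 4 → P3}
  (hlam : ∀ i, lam i = C (c i) + ∑ d, C (N i d) * X d)
include hlam

omit h in
theorem eval_lam (i : Fin 4) (y : V3) : eval y (lam i) = c i + N i ⬝ᵥ y := by
  simp [hlam, dotProduct]

include h

theorem eval_lam_sum (i : Fin 4) {v : Fin 4 → ℝ} (hv : ∑ m, v m = 1) :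
    eval (∑ m, v m • x m) (lam i) = v i := by
  have : c i = ∑ m, v m * c i := by rw [← Finset.sum_mul, hv, one_mul]
  rw [eval_lam hlam, dotProduct_sum, this, ← Finset.sum_add_distrib]
  simp_rw [dotProduct_smul, smul_eq_mul, ← mul_add, h.pairing]
  simp

theorem eval_sum_smul {Q : MvPolynomial (Fin 4) ℝ} {v : Fin 4 → ℝ} (hv : ∑ m, v m = 1) :
    eval (∑ m, v m • x m) (aeval lam Q) = eval v Q := by
  rw [aeval_def, eval_eval₂, eval, coe_eval₂Hom]
  congr 1
  · ext; simp
  · ext m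
    exact h.eval_lam_sum hlam m hv

theorem sum_lam : ∑ i, lam i = 1 := by
  refine MvPolynomial.funext fun y => ?_
  simp only [map_sum, eval_lam hlam, Finset.sum_add_distrib, h.sum_const, ← sum_dotProduct,
    h.sum_grad_eq_zero, zero_dotProduct, add_zero, map_one]

theorem sum_vertex_mul_lam (d : Fin 3) : ∑ i, C (x i d) * lam i = X d := by
  refine MvPolynomial.funext fun y => ?_
  simp only [map_sum, map_mul, eval_C, eval_lam hlam, eval_X, mul_add, Finset.sum_add_distrib]
  simp_rw [mul_comm (x _ d) (c _), h.sum_const_smul, zero_add, dotProduct, Finset.mul_sum]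
  rw [Finset.sum_comm]
  simp_rw [fun e i => show x i d * (N i e * y e) = y e * (N i e * x i d) by ring,
    ← Finset.mul_sum, h.sum_grad_smul]
  simp

theorem totalDegree_ge_one (i : Fin 4) : 1 ≤ (lam i).totalDegree := by
  by_contra! h0
  obtain ⟨j, hj⟩ := exists_ne i
  have hC := totalDegree_eq_zero_iff_eq_C.1 (Nat.lt_one_iff.1 h0)
  have h1 := h.pairing i i
  have h2 := h.pairing i j
  rw [← eval_lam hlam, hC, eval_C] at h1 h2
  simp [hj.symm] at h1 h2
  linarith

theorem eval_lam_bary (i : Fin 4) : eval (bary x) (lam i) = 1 / 4 := by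
  have hb : bary x = ∑ m, (4 : ℝ)⁻¹ • x m := by
    simp [bary, Fin.sum_univ_four]
  rw [hb, h.eval_lam_sum hlam i (v := fun _ => (4 : ℝ)⁻¹) (by simp)]
  norm_num

theorem eval_lam_of_mem_intFace {i j : Fin 4} {y : V3} (hy : y ∈ intFace x i j) :
    eval y (lam i) = eval y (lam j) ∧ 0 ≤ eval y (lam i) := by
  have hcomb : ∀ k (a b : ℝ) (y y' : V3), a + b = 1 → eval (a • y + b • y') (lam k) =
      a * eval y (lam k) + b * eval y' (lam k) := by
    intro k a b y y' hab
    simp only [eval_lam hlam, dotProduct_add, dotProduct_smul, smul_eq_mul]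
    linear_combination - c k * hab
  refine convexHull_min (t := {y | eval y (lam i) = eval y (lam j) ∧ 0 ≤ eval y (lam i)})
    ?_ ?_ hy
  · rintro _ (rfl | ⟨k, ⟨hki, hkj⟩, rfl⟩)
    · rw [Set.mem_ofPred_eq, h.eval_lam_bary hlam, h.eval_lam_bary hlam]
      norm_num
    · simp [eval_lam hlam, h.pairing, hki.symm, hkj.symm]
  · rintro y ⟨h1, h2⟩ y' ⟨h1', h2'⟩ a b ha hb hab
    rw [Set.mem_ofPred_eq, hcomb _ _ _ _ _ hab, hcomb _ _ _ _ _ hab, h1, h1']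
    rw [h1] at h2
    rw [h1'] at h2'
    exact ⟨rfl, by positivity⟩

end IsDual

/-- A field whose normal component vanishes on a boundary face is orthogonal there to the gradient
of the corresponding barycentric coordinate. -/
theorem dotProduct_grad_eq_zero_of_bdry {x N : Fin 4 → V3} {c : Fin 4 → ℝ} (h : IsDual x N c)
    {i : Fin 4} {f : V3 → V3}
    (hf : ∀ n, IsUnitNormalBdry x i n → ∀ y ∈ bdryFace x i, f y ⬝ᵥ n = 0)
    {y : V3} (hy : y ∈ bdryFace x i) : f y ⬝ᵥ N i = 0 := by
  obtain ⟨t, ht, hunit⟩ := exists_unit_smul (h.grad_ne_zero i)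
  have := hf (t • N i) ⟨hunit, fun j k hj hk => by
    rw [smul_dotProduct, h.pairing_sub, if_neg hj.symm, if_neg hk.symm, sub_zero, smul_zero]⟩ y hy
  rw [dotProduct_smul, smul_eq_mul] at this
  exact (mul_eq_zero.1 this).resolve_left ht

/-- A field whose normal component vanishes on an interior face is orthogonal there to the
difference of the gradients of the two adjacent barycentric coordinates. -/
theorem dotProduct_grad_sub_eq_zero_of_int {x N : Fin 4 → V3} {c : Fin 4 → ℝ} (h : IsDual x N c)
    {i j : Fin 4} (hij : i ≠ j) {f : V3 → V3}
    (hf : ∀ n, IsUnitNormalInt x i j n → ∀ y ∈ intFace x i j, f y ⬝ᵥ n = 0)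
    {y : V3} (hy : y ∈ intFace x i j) : f y ⬝ᵥ (N i - N j) = 0 := by
  obtain ⟨t, ht, hunit⟩ := exists_unit_smul (h.grad_sub_ne_zero hij)
  have := hf (t • (N i - N j)) ⟨hunit, fun k hi hj => by
    rw [smul_dotProduct, h.grad_sub_orthogonal hi hj, smul_zero]⟩ y hy
  rw [dotProduct_smul, smul_eq_mul] at this
  exact (mul_eq_zero.1 this).resolve_left ht

/-- A polynomial field whose normal jump vanishes on an interior face after multiplication by a
barycentric coordinate has vanishing normal jump there. -/
theorem normal_continuous_of_mul {x N : Fin 4 → V3} {c : Fin 4 → ℝ} (h : IsDual x N c)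
    {lam : Fin 4 → P3} (hlam : ∀ i, lam i = C (c i) + ∑ d, C (N i d) * X d) {i j : Fin 4}
    {f g : VP3} {n : V3}
    (hfg : ∀ y ∈ intFace x i j, eval y (lam i) * ((evalV f y - evalV g y) ⬝ᵥ n) = 0)
    {y : V3} (hy : y ∈ intFace x i j) : (evalV f y - evalV g y) ⬝ᵥ n = 0 := by
  have hcont : Continuous fun t : ℝ => (evalV f (y + t • (bary x - y)) -
      evalV g (y + t • (bary x - y))) ⬝ᵥ n := by
    have hev : ∀ q : P3, Continuous fun t : ℝ => eval (y + t • (bary x - y)) q := fun q =>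
      (MvPolynomial.continuous_eval q).comp (by fun_prop)
    simp only [dotProduct, evalV, Pi.sub_apply]
    exact continuous_finsetSum _ fun d _ => ((hev _).sub (hev _)).mul continuous_const
  have hz : bary x ∈ intFace x i j := subset_convexHull ℝ _ (Set.mem_insert _ _)
  have hev : ∀ᶠ t : ℝ in nhdsWithin 0 (Set.Ioi 0), (evalV f (y + t • (bary x - y)) -
      evalV g (y + t • (bary x - y))) ⬝ᵥ n = 0 := by
    filter_upwards [Ioo_mem_nhdsGT (zero_lt_one' ℝ)] with t ht
    have hmem : y + t • (bary x - y) ∈ intFace x i j :=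
      (convex_convexHull ℝ _).add_smul_sub_mem hy hz ⟨ht.1.le, ht.2.le⟩
    refine (mul_eq_zero.1 (hfg _ hmem)).resolve_left (ne_of_gt ?_)
    have h1 := (h.eval_lam_of_mem_intFace hlam hy).2
    have h2 := h.eval_lam_bary hlam i
    rw [IsDual.eval_lam hlam] at h1 h2 ⊢
    rw [dotProduct_add, dotProduct_smul, dotProduct_sub, smul_eq_mul]
    nlinarith [ht.1, ht.2, mul_nonneg (sub_nonneg.2 ht.2.le) h1]
  have hlim := (hcont.tendsto 0).mono_left (nhdsWithin_le_nhds (s := Set.Ioi 0))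
  have := tendsto_nhds_unique (hlim.congr' hev) tendsto_const_nhds
  simpa using this

end Alfeld

/-- the key decomposition `μ^ℓ p = curl(μ^{ℓ+1} γ) + μ^{ℓ+1} ψ` on each piece
of the Alfeld split, where `μ|_{T_i} = 4 λ_i`. -/
theorem statement8 (r l : ℕ) (hr : 1 ≤ r) (x : Fin 4 → V3) (hx : AffineIndependent ℝ x)
    (lam : Fin 4 → P3) (hlamdeg : ∀ i, (lam i).totalDegree ≤ 1)
    (hlam : ∀ i j, eval (x j) (lam i) = if i = j then 1 else 0)
    (p : Fin 4 → VP3) (hdeg : ∀ i, degVle (p i) r)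
    (hnormInt : ∀ i j, i ≠ j → ∀ n, IsUnitNormalInt x i j n →
      ∀ y ∈ intFace x i j, (evalV (p i) y - evalV (p j) y) ⬝ᵥ n = 0)
    (hnormBdry : ∀ i, ∀ n, IsUnitNormalBdry x i n →
      ∀ y ∈ bdryFace x i, evalV (p i) y ⬝ᵥ n = 0) :
    ∃ (γ : VP3) (ψ : Fin 4 → VP3),
      degVle γ r ∧ (∀ i, degVle (ψ i) (r - 1)) ∧
      (∀ i j, i ≠ j → ∀ n, IsUnitNormalInt x i j n →
        ∀ y ∈ intFace x i j, (evalV (ψ i) y - evalV (ψ j) y) ⬝ᵥ n = 0) ∧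
      (∀ i, (fun c => (4 * lam i) ^ l * p i c)
          = pcurl (fun c => (4 * lam i) ^ (l + 1) * γ c)
            + fun c => (4 * lam i) ^ (l + 1) * ψ i c) := by
  obtain ⟨N, c, h, haff⟩ := exists_isDual hlamdeg hlam
  have hhom : ∀ i d, ∃ Q : MvPolynomial (Fin 4) ℝ, Q.IsHomogeneous r ∧ aeval lam Q = p i d :=
    fun i d => exists_homogenization_s8 (h.sum_lam haff) (h.sum_vertex_mul_lam haff) (hdeg i d)
  choose P hP hPp using hhom
  have hPeval : ∀ i (v : Fin 4 → ℝ), ∑ m, v m = 1 →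
      (fun d => eval v (P i d)) = evalV (p i) (∑ m, v m • x m) := fun i v hv => by
    ext d
    rw [evalV, ← hPp, h.eval_sum_smul haff hv]
  have hNhom : ∀ i (M : V3), (∑ d, P i d * C (M d)).IsHomogeneous r := fun i M =>
    IsHomogeneous.sum _ _ _ fun d _ => by simpa using (hP i d).mul (isHomogeneous_C _ (M d))
  have hNeval : ∀ i (M : V3) v, eval v (∑ d, P i d * C (M d)) =
      (fun d => eval v (P i d)) ⬝ᵥ M := fun i M v => by
    simp [dotProduct]
  have hN : ∀ i (v : Fin 4 → ℝ), v i = 0 → (fun d => eval v (P i d)) ⬝ᵥ N i = 0 := by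
    intro i v hv
    rw [← hNeval]
    refine eval_eq_zero_of_eval_simplex (hNhom i _) (fun v hi _ hnn hsum => ?_) hv hv
    rw [hNeval, hPeval i v hsum]
    exact dotProduct_grad_eq_zero_of_bdry h (hnormBdry i) (sum_smul_mem_convexHull x hnn hsum
      fun m hm => by rwa [not_not.1 hm])
  have hE : ∀ i j, i ≠ j → ∀ v : Fin 4 → ℝ, v i = 0 → v j = 0 →
      (fun d => eval v (P i d)) ⬝ᵥ N j + (fun d => eval v (P j d)) ⬝ᵥ N i = 0 := by
    intro i j hij v hvi hvj
    rw [← hNeval, ← hNeval, ← map_add]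
    refine eval_eq_zero_of_eval_simplex ((hNhom i _).add (hNhom j _))
      (fun v hi hj hnn hsum => ?_) hvi hvj
    have hmem : ∑ m, v m • x m ∈ intFace x i j :=
      convexHull_mono (Set.subset_insert _ _) (sum_smul_mem_convexHull x hnn hsum fun m hm => by
        rcases not_and_or.1 hm with hm | hm
        · rwa [not_not.1 hm]
        · rwa [not_not.1 hm])
    have h0 := dotProduct_grad_sub_eq_zero_of_int h hij (hnormInt i j hij) hmem
    rw [← hPeval i v hsum, ← hPeval j v hsum, sub_dotProduct, dotProduct_sub, dotProduct_sub,
      hN i v hi, hN j v hj] at h0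
    rw [map_add, hNeval, hNeval]
    linarith
  have hK : (4 * (l + 1) : ℝ) ≠ 0 := by positivity
  obtain ⟨G, hG, hGP⟩ := exists_tangential_extension hr h hK P hP hN hE
  set γ : VP3 := fun d => aeval lam (G d) with hγ
  have hγdeg : degVle γ r := fun d => totalDegree_aeval_le (hG d).totalDegree_le hlamdeg
  have hdvd : ∀ i d, ∃ q, p i d - C (4 * (l + 1) : ℝ) * pcross (fun e => C (N i e)) γ d =
      lam i * q := by
    intro i d
    have hX : X i ∣ P i d - C (4 * (l + 1) : ℝ) * (C (N i (d + 1)) * G (d + 2) -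
        C (N i (d + 2)) * G (d + 1)) := by
      refine X_dvd_of_coeff fun α hα => coeff_eq_zero_of_eval_pos {i} _ (fun v hv _ => ?_) α ?_
      · have := congrFun (hGP i v (hv i rfl)) d
        simp only [cross3, Pi.smul_apply, smul_eq_mul] at this
        simp only [map_sub, map_mul, eval_C, this, sub_self]
      · rintro m rfl
        exact hα
    have hdvd := map_dvd (aeval lam) hX
    simp only [map_sub, map_mul, aeval_X, aeval_C, algebraMap_eq, hPp] at hdvd
    simpa only [map_mul, pcross] using exists_eq_mul_right_of_dvd hdvd
  choose q hq using hdvd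
  have hqdeg : ∀ i d, (q i d).totalDegree ≤ r - 1 := by
    intro i d
    by_cases hq0 : q i d = 0
    · simp [hq0]
    have hlam0 : lam i ≠ 0 := fun h0 => by simpa [h0] using h.totalDegree_ge_one haff i
    have h1 := totalDegree_mul_of_isDomain hlam0 hq0
    have hcross : (pcross (fun e => C (N i e)) γ d).totalDegree ≤ r := by
      refine (totalDegree_sub _ _).trans (max_le ?_ ?_) <;>
      · refine (totalDegree_mul _ _).trans ?_
        rw [totalDegree_C, zero_add]
        exact hγdeg _
    have h2 : (lam i * q i d).totalDegree ≤ r := by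
      rw [← hq]
      refine (totalDegree_sub _ _).trans (max_le (hdeg i d) ?_)
      refine (totalDegree_mul _ _).trans ?_
      rw [totalDegree_C, zero_add]
      exact hcross
    have h3 := h.totalDegree_ge_one haff i
    omega
  have hcurl : degVle (pcurl γ) (r - 1) := fun d =>
    (totalDegree_sub _ _).trans (max_le
      ((totalDegree_pderiv_le_sub_one _ _).trans (Nat.sub_le_sub_right (hγdeg _) 1))
      ((totalDegree_pderiv_le_sub_one _ _).trans (Nat.sub_le_sub_right (hγdeg _) 1)))
  refine ⟨γ, fun i d => C (1 / 4 : ℝ) * q i d - pcurl γ d, hγdeg, fun i d => ?_, ?_, fun i => ?_⟩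
  · refine (totalDegree_sub _ _).trans (max_le ((totalDegree_mul _ _).trans ?_) (hcurl d))
    rw [totalDegree_C, zero_add]
    exact hqdeg i d
  · intro i j hij n hn y hy
    obtain ⟨t, ht⟩ := h.exists_eq_smul_sub hij hn.2
    refine normal_continuous_of_mul h haff (fun y hy => ?_) hy
    have hlamy := (h.eval_lam_of_mem_intFace haff hy).1
    have hqy : ∀ k d, eval y (lam k) * eval y (q k d) = evalV (p k) y d -
        4 * (l + 1) * cross3 (N k) (evalV γ y) d := fun k d => by
      rw [← map_mul, ← hq]
      simp [pcross, cross3, evalV]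
    have hpn := hnormInt i j hij n hn y hy
    have hvec : eval y (lam i) • (evalV (fun d => C (1 / 4 : ℝ) * q i d - pcurl γ d) y -
        evalV (fun d => C (1 / 4 : ℝ) * q j d - pcurl γ d) y) = (1 / 4 : ℝ) •
        ((evalV (p i) y - evalV (p j) y) -
          (4 * (l + 1) : ℝ) • crossProduct (N i - N j) (evalV γ y)) := by
      ext d
      have h1 := hqy i d
      have h2 := hqy j d
      rw [← hlamy] at h2
      simp only [cross3_eq_crossProduct] at h1 h2
      simp only [map_sub, LinearMap.sub_apply, Pi.smul_apply, Pi.sub_apply, smul_eq_mul, evalV,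
        map_mul, eval_C] at h1 h2 ⊢
      linear_combination (1 / 4) * h1 - (1 / 4) * h2
    rw [← smul_eq_mul, ← smul_dotProduct, hvec, smul_dotProduct, sub_dotProduct, hpn,
      smul_dotProduct, ht, dotProduct_smul, dotProduct_comm, dot_self_cross]
    simp
  · ext1 d
    have h1 := hq i d
    have hgrad : ∀ e, pderiv e (4 * lam i) = 4 * C (N i e) := fun e => by
      rw [haff i, show (4 : P3) = C 4 from rfl, pderiv_C_mul]
      simp [pderiv_X, Pi.single_apply]
    simp only [Pi.add_apply, pcurl, pderiv_mul, pderiv_pow, hgrad, Nat.add_sub_cancel]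
    have hC : (C (4 * (l + 1) : ℝ) : P3) = 4 * (l + 1) := by
      simp [show (C 4 : P3) = 4 from rfl]
    have h4 : (4 : P3) * C (1 / 4 : ℝ) = 1 := by
      rw [show (4 : P3) = C 4 from rfl, ← C_mul]
      norm_num
    simp only [pcross, hC] at h1
    push_cast
    linear_combination (4 * lam i) ^ l * h1 - (4 * lam i) ^ l * lam i * q i d * h4
end
end

section
/- Let r ≥ 0 be an integer and let (p₀,p₁,p₂,p₃) be a piecewise polynomial vector field of degree ≤ r on the Alfeld split T^z of a tetrahedron T ⊂ ℝ³ such that both p and curl p are continuous across interior faces, i.e. p_i = p_j and curl p_i = curl p_j at every point of F_{ij} for all i ≠ j. Then p is C¹ at every vertex of T^z: for every a ∈ {x₀, x₁, x₂, x₃, z} and all indices i, j with a ∈ T_i ∩ T_j, the total derivatives agree, Dp_i(a) = Dp_j(a). -/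
open MvPolynomial Matrix

noncomputable section

open Alfeld

namespace Alfeld

/-- Chain rule for a polynomial along a line. -/
theorem hasDerivAt_eval_line (q : P3) (a v : V3) (t : ℝ) :
    HasDerivAt (fun s : ℝ => eval (a + s • v) q)
      (∑ c, eval (a + t • v) (pderiv c q) * v c) t := by
  induction q using MvPolynomial.induction_on with
  | C r => simpa using hasDerivAt_const t r
  | add f g hf hg =>
    refine ((hf.add hg).congr_of_eventuallyEq (.of_forall fun s => ?_)).congr_deriv ?_
    · simp
    · simp [add_mul, Finset.sum_add_distrib]
  | mul_X f n hf =>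
    have hX : HasDerivAt (fun s : ℝ => a n + s * v n) (v n) t := by
      simpa using ((hasDerivAt_id t).mul_const (v n)).const_add (a n)
    refine ((hf.mul hX).congr_of_eventuallyEq (.of_forall fun s => ?_)).congr_deriv ?_
    · simp
    · simp only [pderiv_mul, pderiv_X, map_add, map_mul, add_mul, eval_X, Finset.sum_add_distrib,
        Finset.sum_mul]
      congr 1
      · refine Finset.sum_congr rfl fun c _ => ?_
        simp only [Pi.add_apply, Pi.smul_apply, smul_eq_mul]
        ring
      · rw [Finset.sum_eq_single n] <;> simp +contextual [eq_comm]

/-- Directional derivatives of two polynomials agreeing on a convex set agree along directions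
pointing into the set. -/
theorem sum_pderiv_eq_of_eqOn_convex {S : Set V3} (hS : Convex ℝ S) {f g : P3}
    (h : ∀ y ∈ S, eval y f = eval y g) {a w : V3} (ha : a ∈ S) (hw : w ∈ S) :
    ∑ c, eval a (pderiv c f) * (w - a) c = ∑ c, eval a (pderiv c g) * (w - a) c := by
  have hf := (hasDerivAt_eval_line f a (w - a) 0).hasDerivWithinAt (s := Set.Icc (0 : ℝ) 1)
  have hg := (hasDerivAt_eval_line g a (w - a) 0).hasDerivWithinAt (s := Set.Icc (0 : ℝ) 1)
  have h0 : (0 : ℝ) ∈ Set.Icc (0 : ℝ) 1 := by simp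
  have hfg := hf.congr_of_mem (fun s hs => (h _ (hS.add_smul_sub_mem ha hw hs)).symm) h0
  simpa using (uniqueDiffOn_Icc (zero_lt_one' ℝ) 0 h0).eq_deriv _ hfg hg

theorem jacob_mulVec_eq_of_eqOn_convex {S : Set V3} (hS : Convex ℝ S) {p q : VP3}
    (h : ∀ y ∈ S, evalV p y = evalV q y) {a w : V3} (ha : a ∈ S) (hw : w ∈ S) :
    Matrix.of (jacob p a) *ᵥ (w - a) = Matrix.of (jacob q a) *ᵥ (w - a) := by
  ext c
  exact sum_pderiv_eq_of_eqOn_convex hS (fun y hy => congrFun (h y hy) c) ha hw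

theorem isSymm_jacob_sub_of_curl_eq {p q : VP3} {a : V3}
    (h : evalV (pcurl p) a = evalV (pcurl q) a) :
    (Matrix.of (jacob p a) - Matrix.of (jacob q a)).IsSymm := by
  have h0 := congrFun h 0
  have h1 := congrFun h 1
  have h2 := congrFun h 2
  simp only [evalV, pcurl, map_sub, Fin.isValue, zero_add, Fin.reduceAdd] at h0 h1 h2
  ext c d
  fin_cases c <;> fin_cases d <;>
    simp only [jacob, Matrix.transpose_apply, Matrix.sub_apply, Matrix.of_apply, Fin.zero_eta,
      Fin.mk_one, Fin.reduceFinMk, Fin.isValue] <;> linarith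

/-- A vector orthogonal to all edges of a nondegenerate tetrahedron vanishes. -/
theorem eq_zero_of_dotProduct_const {x : Fin 4 → V3} (hx : AffineIndependent ℝ x) {u : V3} {t : ℝ}
    (h : ∀ m, u ⬝ᵥ x m = t) : u = 0 := by
  have htop : vectorSpan ℝ (Set.range x) = ⊤ :=
    hx.vectorSpan_eq_top_of_card_eq_finrank_add_one (by simp)
  have hu : u ∈ vectorSpan ℝ (Set.range x) := htop ▸ Submodule.mem_top
  have key : ∀ v ∈ vectorSpan ℝ (Set.range x), u ⬝ᵥ v = 0 := by
    intro v hv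
    refine Submodule.span_induction ?_ (by simp) (fun v w _ _ hv hw => by simp [hv, hw])
      (fun r v _ hv => by simp [hv]) hv
    rintro _ ⟨_, ⟨m, rfl⟩, _, ⟨n, rfl⟩, rfl⟩
    simp [dotProduct_sub, h]
  exact dotProduct_self_eq_zero.1 (key u hu)

/-- A vector orthogonal to `x m - bary x` for three of the vertices vanishes. -/
theorem eq_zero_of_dotProduct_sub_bary {x : Fin 4 → V3} (hx : AffineIndependent ℝ x) {u : V3}
    (i : Fin 4) (h : ∀ m, m ≠ i → u ⬝ᵥ (x m - bary x) = 0) : u = 0 := by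
  refine eq_zero_of_dotProduct_const hx (t := u ⬝ᵥ bary x) fun m => ?_
  have hb : u ⬝ᵥ bary x = 4⁻¹ * (u ⬝ᵥ x 0 + u ⬝ᵥ x 1 + u ⬝ᵥ x 2 + u ⬝ᵥ x 3) := by
    simp only [bary, dotProduct_smul, dotProduct_add, smul_eq_mul]
  simp only [dotProduct_sub] at h
  have h0 := h 0
  have h1 := h 1
  have h2 := h 2
  have h3 := h 3
  fin_cases i <;> fin_cases m <;> simp at h0 h1 h2 h3 ⊢ <;> linarith

/-- Symmetric matrices `A`, `B`, `C` with zero sum, which are the jumps of the Jacobian across the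
three interior faces meeting at an edge of the Alfeld split, vanish. -/
theorem eq_zero_of_jumps {x : Fin 4 → V3} (hx : AffineIndependent ℝ x)
    {i j k l : Fin 4} (hc : ∀ m, m = i ∨ m = j ∨ m = k ∨ m = l)
    {A B C : Matrix (Fin 3) (Fin 3) ℝ} (hA : A.IsSymm) (hB : B.IsSymm)
    (hABC : A + B + C = 0)
    (hAk : A *ᵥ (x k - bary x) = 0) (hAl : A *ᵥ (x l - bary x) = 0)
    (hBi : B *ᵥ (x i - bary x) = 0)
    (hCj : C *ᵥ (x j - bary x) = 0) : A = 0 := by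
  have symm : ∀ {M : Matrix (Fin 3) (Fin 3) ℝ}, M.IsSymm → ∀ u v, (M *ᵥ u) ⬝ᵥ v = u ⬝ᵥ (M *ᵥ v) := by
    intro M hM u v
    rw [dotProduct_mulVec, ← mulVec_transpose, hM.eq]
  have hAij : (A *ᵥ (x i - bary x)) ⬝ᵥ (x j - bary x) = 0 := by
    have hA' : A = -B - C := by rw [← sub_eq_zero, ← hABC]; abel
    have hBij := symm hB (x i - bary x) (x j - bary x)
    rw [hBi, zero_dotProduct] at hBij
    rw [symm hA, hA', sub_mulVec, neg_mulVec, hCj, sub_zero, dotProduct_neg, ← hBij, neg_zero]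
  have hAi : A *ᵥ (x i - bary x) = 0 := by
    refine eq_zero_of_dotProduct_sub_bary hx i fun m hm => ?_
    rcases hc m with rfl | rfl | rfl | rfl
    · exact absurd rfl hm
    · exact hAij
    · rw [symm hA, hAk, dotProduct_zero]
    · rw [symm hA, hAl, dotProduct_zero]
  ext c d
  refine congrFun (eq_zero_of_dotProduct_sub_bary hx j (u := A c) fun m hm => ?_) d
  rcases hc m with rfl | rfl | rfl | rfl
  · exact congrFun hAi c
  · exact absurd rfl hm
  · exact congrFun hAk c
  · exact congrFun hAl c

/-- On the two endpoints of the interior edge through `x l`, the Jacobians of the pieces meeting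
there agree. -/
theorem jacob_eq_of_edge {x : Fin 4 → V3} (hx : AffineIndependent ℝ x) {p : Fin 4 → VP3}
    (hcont : ∀ i j, i ≠ j → ∀ y ∈ intFace x i j, evalV (p i) y = evalV (p j) y)
    (hcurlcont : ∀ i j, i ≠ j → ∀ y ∈ intFace x i j,
      evalV (pcurl (p i)) y = evalV (pcurl (p j)) y)
    {i j k l : Fin 4} (hij : i ≠ j) (hik : i ≠ k) (hil : i ≠ l) (hjk : j ≠ k) (hjl : j ≠ l)
    (hkl : k ≠ l) {a : V3} (ha : a = bary x ∨ a = x l) :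
    jacob (p i) a = jacob (p j) a := by
  have hz : ∀ m n, bary x ∈ intFace x m n := fun m n =>
    subset_convexHull ℝ _ (Set.mem_insert _ _)
  have hv : ∀ {m n o}, o ≠ m → o ≠ n → x o ∈ intFace x m n := fun h h' =>
    subset_convexHull ℝ _ (Set.mem_insert_of_mem _ ⟨_, ⟨h, h'⟩, rfl⟩)
  have haF : ∀ {m n}, l ≠ m → l ≠ n → a ∈ intFace x m n := by
    intro m n h h'
    rcases ha with rfl | rfl
    · exact hz m n
    · exact hv h h'
  have kill : ∀ {m n o}, m ≠ n → l ≠ m → l ≠ n → o ≠ m → o ≠ n →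
      (Matrix.of (jacob (p m) a) - Matrix.of (jacob (p n) a)) *ᵥ (x o - bary x) = 0 := by
    intro m n o hmn hlm hln hom hon
    have h1 := jacob_mulVec_eq_of_eqOn_convex (convex_convexHull ℝ _) (hcont m n hmn)
      (haF hlm hln) (hv hom hon)
    have h2 := jacob_mulVec_eq_of_eqOn_convex (convex_convexHull ℝ _) (hcont m n hmn)
      (haF hlm hln) (hz m n)
    rw [← sub_sub_sub_cancel_right (x o) (bary x) a, mulVec_sub, sub_mulVec, sub_mulVec, h1, h2]
    simp
  have hsymm : ∀ {m n}, m ≠ n → l ≠ m → l ≠ n →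
      (Matrix.of (jacob (p m) a) - Matrix.of (jacob (p n) a)).IsSymm := fun hmn hlm hln =>
    isSymm_jacob_sub_of_curl_eq (hcurlcont _ _ hmn _ (haF hlm hln))
  have hc : ∀ m, m = i ∨ m = j ∨ m = k ∨ m = l := by omega
  have := eq_zero_of_jumps hx hc (hsymm hij hil.symm hjl.symm) (hsymm hjk hjl.symm hkl.symm)
    (C := Matrix.of (jacob (p k) a) - Matrix.of (jacob (p i) a)) (by abel)
    (kill hij hil.symm hjl.symm hik.symm hjk.symm) (kill hij hil.symm hjl.symm hil.symm hjl.symm)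
    (kill hjk hjl.symm hkl.symm hij hik) (kill hik.symm hkl.symm hil.symm hjk hij.symm)
  exact Matrix.of.injective (sub_eq_zero.1 this)

theorem apply_bary (x : Fin 4 → V3) (f : V3 →ᵃ[ℝ] ℝ) :
    f (bary x) = 4⁻¹ * (f (x 0) + f (x 1) + f (x 2) + f (x 3)) := by
  have h : ∀ y, f y = f.linear y + f 0 := fun y => congrFun f.decomp y
  rw [h (bary x), h (x 0), h (x 1), h (x 2), h (x 3)]
  simp only [bary, map_smul, map_add, smul_eq_mul]
  ring

theorem notMem_piece_self {x : Fin 4 → V3} (hx : AffineIndependent ℝ x) (i : Fin 4) :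
    x i ∉ piece x i := by
  let b : AffineBasis (Fin 4) ℝ V3 :=
    ⟨x, hx, hx.affineSpan_eq_top_iff_card_eq_finrank_add_one.2 (by simp)⟩
  have hcoord : ∀ m, b.coord i (x m) = if i = m then 1 else 0 := b.coord_apply i
  have hsub : piece x i ⊆ b.coord i ⁻¹' Set.Iic (4⁻¹ : ℝ) := by
    refine convexHull_min ?_ ((convex_Iic _).affine_preimage _)
    rintro y (rfl | ⟨m, hm, rfl⟩)
    · rw [Set.mem_preimage, apply_bary]
      simp only [hcoord]
      fin_cases i <;> simp
    · rw [Set.mem_preimage, hcoord, if_neg (Ne.symm hm)]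
      simp
  intro h
  have h1 := hsub h
  rw [Set.mem_preimage, hcoord, if_pos rfl, Set.mem_Iic] at h1
  norm_num at h1

end Alfeld

/-- if a piecewise polynomial vector field and its curl are continuous across
the interior faces of an Alfeld split, then the field is `C¹` at every vertex. -/
theorem statement9 (r : ℕ) (x : Fin 4 → V3) (hx : AffineIndependent ℝ x)
    (p : Fin 4 → VP3) (hdeg : ∀ i, degVle (p i) r)
    (hcont : ∀ i j, i ≠ j → ∀ y ∈ intFace x i j, evalV (p i) y = evalV (p j) y)
    (hcurlcont : ∀ i j, i ≠ j → ∀ y ∈ intFace x i j,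
      evalV (pcurl (p i)) y = evalV (pcurl (p j)) y) :
    ∀ a ∈ vertices x, ∀ i j, a ∈ piece x i → a ∈ piece x j →
      jacob (p i) a = jacob (p j) a := by
  intro a ha i j hi hj
  rcases eq_or_ne i j with rfl | hij
  · rfl
  rcases ha with rfl | ⟨l, rfl⟩
  · obtain ⟨k, l, hik, hil, hjk, hjl, hkl⟩ :
        ∃ k l : Fin 4, i ≠ k ∧ i ≠ l ∧ j ≠ k ∧ j ≠ l ∧ k ≠ l := by
      clear hi hj
      revert i j
      decide
    exact jacob_eq_of_edge hx hcont hcurlcont hij hik hil hjk hjl hkl (Or.inl rfl)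
  · have hil : i ≠ l := fun h => notMem_piece_self hx i (h ▸ hi)
    have hjl : j ≠ l := fun h => notMem_piece_self hx j (h ▸ hj)
    obtain ⟨k, hik, hjk, hkl⟩ : ∃ k : Fin 4, i ≠ k ∧ j ≠ k ∧ k ≠ l := by
      clear hi hj
      revert i j l
      decide
    exact jacob_eq_of_edge hx hcont hcurlcont hij hik hil hjk hjl hkl (Or.inr rfl)
end
end
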